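/- arXiv:1403.4385 — 3 statements merged into one kernel-verified Lean document; each statement's English description precedes it below -/
import Mathlib

section
/- Let A and B be simple unital complex C*-algebras with A oddly decomposable, φ : GL(A) → GL(B) a group isomorphism, and θ the induced map on idempotents. Let e, f ∈ Ĩ(A) be nontrivial idempotents that are not ∼_c-equivalent (c_e ≠ c_f). If θ preserves orthogonality on I_{c_e} (i.e. θ(g)θ(h) = 0 for all orthogonal g, h ∈ I_{c_e}), then θ flips orthogonality on I_{c_f} (i.e. θ(1 − g)θ(1 − h) = 0 for all orthogonal g, h ∈ I_{c_f}); and if θ flips orthogonality on I_{c_e}, then θ preserves orthogonality on I_{c_f}. -/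
noncomputable section

/-- The symmetry `1 - 2e` associated to an idempotent `e` is a unit (its own inverse). -/
def symUnit {A : Type*} [Ring A] {e : A} (he : IsIdempotentElem e) : Aˣ where
  val := 1 - 2 * e
  inv := 1 - 2 * e
  val_inv := by
    have h : e * e = e := he
    have expand : (1 - 2 * e) * (1 - 2 * e) = 1 - 4 * e + 4 * (e * e) := by noncomm_ring
    rw [expand, h]; noncomm_ring
  inv_val := by
    have h : e * e = e := he
    have expand : (1 - 2 * e) * (1 - 2 * e) = 1 - 4 * e + 4 * (e * e) := by noncomm_ring
    rw [expand, h]; noncomm_ring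

/-- The map `θ_φ` induced on idempotents by a map `φ` between the groups of invertible
elements, determined by `1 - 2 θ_φ(e) = φ(1 - 2e)`, i.e. `θ_φ(e) = (1 - φ(1 - 2e))/2`;
it is extended by `0` off the set of idempotents. -/
noncomputable def theta {A B : Type*} [Ring A] [Ring B] [Algebra ℂ B]
    (φ : Aˣ → Bˣ) (e : A) : B :=
  letI := Classical.propDecidable (IsIdempotentElem e)
  if h : IsIdempotentElem e then (2 : ℂ)⁻¹ • ((1 : B) - (φ (symUnit h) : B)) else 0

/-- `a` and `b` are coefficient maps for the idempotent `e` (w.r.t. `φ`):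
`φ(λe + 1 - e) = a(λ) θ(e) + b(λ) θ(1-e)` for all nonzero `λ`. -/
def IsCoeffMaps {A B : Type*} [Ring A] [Ring B] [Algebra ℂ A] [Algebra ℂ B]
    (φ : Aˣ → Bˣ) (e : A) (a b : ℂˣ →* ℂˣ) : Prop :=
  ∀ (lam : ℂˣ) (v : Aˣ), (v : A) = (lam : ℂ) • e + 1 - e →
    (φ v : B) = ((a lam : ℂˣ) : ℂ) • theta φ e + ((b lam : ℂˣ) : ℂ) • theta φ (1 - e)

/-- `c(λ) = a(λ) b(λ)⁻¹`, as an element of `ℂˣ`. -/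
def cOf (a b : ℂˣ →* ℂˣ) (lam : ℂˣ) : ℂˣ := a lam * (b lam)⁻¹

/-- `e ∼_c f`: the functions `c_e` and `c_f` agree (for some, equivalently any,
choice of coefficient maps). -/
def cEquiv {A B : Type*} [Ring A] [Ring B] [Algebra ℂ A] [Algebra ℂ B]
    (φ : Aˣ → Bˣ) (e f : A) : Prop :=
  ∃ ae be af bf : ℂˣ →* ℂˣ, IsCoeffMaps φ e ae be ∧ IsCoeffMaps φ f af bf ∧
    ∀ lam : ℂˣ, cOf ae be lam = cOf af bf lam

/-- The set `I_{c_e}` of nontrivial idempotents `g` with `c_g = c_e`. -/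
def Ic {A B : Type*} [Ring A] [Ring B] [Algebra ℂ A] [Algebra ℂ B]
    (φ : Aˣ → Bˣ) (e : A) : Set A :=
  {g | IsIdempotentElem g ∧ g ≠ 0 ∧ g ≠ 1 ∧ cEquiv φ e g}

/-- `θ_φ` preserves orthogonality on `S`: `θ(g₁)θ(g₂) = 0` for orthogonal `g₁, g₂ ∈ S`. -/
def PreservesOrthOn {A B : Type*} [Ring A] [Ring B] [Algebra ℂ B]
    (φ : Aˣ → Bˣ) (S : Set A) : Prop :=
  ∀ g₁ ∈ S, ∀ g₂ ∈ S, g₁ * g₂ = 0 → g₂ * g₁ = 0 → theta φ g₁ * theta φ g₂ = 0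

/-- `θ_φ` flips orthogonality on `S`: `θ(1-g₁)θ(1-g₂) = 0` for orthogonal `g₁, g₂ ∈ S`. -/
def FlipsOrthOn {A B : Type*} [Ring A] [Ring B] [Algebra ℂ B]
    (φ : Aˣ → Bˣ) (S : Set A) : Prop :=
  ∀ g₁ ∈ S, ∀ g₂ ∈ S, g₁ * g₂ = 0 → g₂ * g₁ = 0 →
    theta φ (1 - g₁) * theta φ (1 - g₂) = 0

/-- A unital ring is oddly decomposable if for every pair of nontrivial idempotents
`e, f` there is an odd integer `n ≥ 3` and `n` pairwise orthogonal nontrivial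
idempotents `g₁, …, gₙ` summing to `f`, such that each `gᵢ` is similar to some
nontrivial idempotent `gᵢ'` with `gᵢ' e = e gᵢ' = gᵢ' ≠ e`. -/
def OddlyDecomposable (A : Type*) [Ring A] : Prop :=
  ∀ e f : A, IsIdempotentElem e → e ≠ 0 → e ≠ 1 → IsIdempotentElem f → f ≠ 0 → f ≠ 1 →
    ∃ n : ℕ, Odd n ∧ 3 ≤ n ∧ ∃ g : Fin n → A,
      (∀ i, IsIdempotentElem (g i) ∧ g i ≠ 0 ∧ g i ≠ 1) ∧
      (∀ i j, i ≠ j → g i * g j = 0) ∧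
      (∑ i, g i) = f ∧
      ∀ i, ∃ (g' : A) (u : Aˣ), IsIdempotentElem g' ∧ g' ≠ 0 ∧ g' ≠ 1 ∧
        g' = (u : A) * g i * ((u⁻¹ : Aˣ) : A) ∧ g' * e = g' ∧ e * g' = g' ∧ g' ≠ e

variable {A B : Type*}
  [NormedRing A] [StarRing A] [CStarRing A] [CompleteSpace A]
  [NormedAlgebra ℂ A] [StarModule ℂ A]
  [NormedRing B] [StarRing B] [CStarRing B] [CompleteSpace B]
  [NormedAlgebra ℂ B] [StarModule ℂ B]


section Corners

variable {S : Type*} [NormedRing S] [NormedAlgebra ℂ S] [CompleteSpace S]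

/-- Elements that commute with every unit of a commutant commute with the whole commutant. -/
lemma commute_of_forall_units_commute {p V y : S}
    (hV : ∀ w : Sˣ, Commute (w : S) p → Commute V w) (hy : Commute y p) : Commute V y := by
  obtain ⟨k, hk⟩ : ∃ k : ℂ, ‖y‖ * ‖(1 : S)‖ < ‖k‖ := NormedField.exists_lt_norm ℂ _
  have hu : IsUnit (algebraMap ℂ S k - y) := spectrum.mem_resolventSet_of_norm_lt_mul hk
  obtain ⟨w, hw⟩ := hu
  have h1 : Commute V (w : S) :=
    hV w (by rw [hw]; exact (Algebra.commute_algebraMap_left k p).sub_left hy)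
  rw [hw] at h1
  simpa using (Algebra.commute_algebraMap_right k V).sub_right h1

/-- In a simple ring, nonzero central elements of a corner are invertible in the corner. -/
lemma exists_corner_inverse {S : Type*} [Ring S] [IsSimpleRing S] {p w : S}
    (hp : IsIdempotentElem p) (hw0 : w ≠ 0) (hw : p * w * p = w)
    (hc : ∀ x, w * (p * x * p) = p * x * p * w) :
    ∃ y, w * (p * y * p) = p := by
  have hp' : p * p = p := hp
  have hpw : p * w = w := by rw [← hw, ← mul_assoc, ← mul_assoc, hp']
  have hwp : w * p = w := by rw [← hw, mul_assoc, hp']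
  have key : ∀ x ∈ TwoSidedIdeal.span {w}, ∀ a b, ∃ y, p * (a * x * b) * p = w * (p * y * p) := by
    intro x hx
    induction hx using TwoSidedIdeal.span_induction with
    | mem x hx =>
      intro a b
      rw [Set.mem_singleton_iff] at hx
      subst hx
      refine ⟨a * p * b, ?_⟩
      have h := hc a
      calc p * (a * x * b) * p = p * (a * (p * x * p) * b) * p := by rw [hw]
        _ = (p * a * p * x) * (p * b * p) := by simp only [mul_assoc]
        _ = x * (p * a * p) * (p * b * p) := by rw [h]
        _ = x * (p * a * (p * p) * b * p) := by simp only [mul_assoc]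
        _ = x * (p * (a * p * b) * p) := by rw [hp']; simp only [mul_assoc]
    | zero => exact fun a b => ⟨0, by simp⟩
    | add x y _ _ hx hy =>
      intro a b
      obtain ⟨u, hu⟩ := hx a b
      obtain ⟨v, hv⟩ := hy a b
      exact ⟨u + v, by simp only [mul_add, add_mul, hu, hv]⟩
    | neg x _ hx =>
      intro a b
      obtain ⟨u, hu⟩ := hx a b
      exact ⟨-u, by simp only [mul_neg, neg_mul, hu]⟩
    | left_absorb c x _ hx =>
      intro a b
      obtain ⟨u, hu⟩ := hx (a * c) b
      exact ⟨u, by rw [← hu]; simp only [mul_assoc]⟩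
    | right_absorb c x _ hx =>
      intro a b
      obtain ⟨u, hu⟩ := hx a (c * b)
      exact ⟨u, by rw [← hu]; simp only [mul_assoc]⟩
  have h1 : (1 : S) ∈ TwoSidedIdeal.span {w} :=
    IsSimpleRing.one_mem_of_ne_zero_mem _ hw0 (TwoSidedIdeal.subset_span rfl)
  obtain ⟨y, hy⟩ := key 1 h1 1 1
  exact ⟨y, by rw [← hy]; simp [hp']⟩

/-- The center of a nonzero corner of a simple Banach algebra consists of scalars. -/
lemma exists_eq_smul_of_central_in_corner [IsSimpleRing S] {p z : S}
    (hp : IsIdempotentElem p) (hp0 : p ≠ 0) (hz : p * z * p = z)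
    (hc : ∀ x, z * (p * x * p) = p * x * p * z) : ∃ α : ℂ, z = α • p := by
  have hp' : p * p = p := hp
  let E : Submodule ℂ S := ((ContinuousLinearMap.mul ℂ S).flip (1 - p)).ker
  have memE : ∀ x, x ∈ E ↔ x * p = x := by
    intro x
    have : x ∈ E ↔ x * (1 - p) = 0 := by simp [E, mul_sub]
    rw [this, mul_sub, mul_one, sub_eq_zero, eq_comm]
  let T : S → (E →L[ℂ] E) := fun y =>
    (((ContinuousLinearMap.mul ℂ S).flip (p * y * p)).comp E.subtypeL).codRestrict E (by
      intro x
      rw [memE]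
      simp [mul_assoc, hp'])
  have hT : ∀ y (x : E), ((T y x : E) : S) = x * (p * y * p) := fun y x => rfl
  have : Nontrivial E := by
    refine ⟨⟨⟨p, (memE p).2 hp'⟩, 0, fun h => hp0 ?_⟩⟩
    simpa using congrArg Subtype.val h
  have : CompleteSpace E :=
    (ContinuousLinearMap.isClosed_ker ((ContinuousLinearMap.mul ℂ S).flip (1 - p))).completeSpace_coe
  obtain ⟨α, hα⟩ := spectrum.nonempty (T z)
  refine ⟨α, ?_⟩
  by_contra hne
  have hpp : p * (α • p) * p = α • p := by simp [hp']
  have hw : p * (α • p - z) * p = α • p - z := by rw [mul_sub, sub_mul, hpp, hz]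
  have hcw : ∀ x, (α • p - z) * (p * x * p) = p * x * p * (α • p - z) := by
    intro x
    rw [sub_mul, mul_sub, hc x, smul_mul_assoc, mul_smul_comm]
    simp only [← mul_assoc, hp']
    simp only [mul_assoc, hp']
  obtain ⟨y, hy⟩ := exists_corner_inverse hp (sub_ne_zero.2 (Ne.symm hne)) hw hcw
  have hval : ∀ x : E, (((algebraMap ℂ (E →L[ℂ] E) α - T z) x : E) : S) = x * (α • p - z) := by
    intro x
    have hx := (memE x).1 x.2
    rw [Algebra.algebraMap_eq_smul_one, mul_sub, mul_smul_comm, hx]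
    simp [hT, hz]
  refine hα ⟨⟨_, T y, ?_, ?_⟩, rfl⟩
  · ext x
    change ((((algebraMap ℂ (E →L[ℂ] E) α - T z) (T y x)) : E) : S) = x
    rw [hval, hT, mul_assoc, ← hcw, hy, (memE x).1 x.2]
  · ext x
    change ((T y ((algebraMap ℂ (E →L[ℂ] E) α - T z) x) : E) : S) = x
    rw [hT, hval, mul_assoc, hy, (memE x).1 x.2]

lemma exists_eq_smul_one_of_central [IsSimpleRing S] {z : S} (hc : ∀ w : Sˣ, Commute z w) :
    ∃ α : ℂ, z = α • (1 : S) := by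
  refine exists_eq_smul_of_central_in_corner (p := (1 : S)) (by simp [IsIdempotentElem]) one_ne_zero
    (by simp) fun x => ?_
  simpa using (commute_of_forall_units_commute (p := (1 : S)) (fun w _ => hc w)
    (Commute.one_right x)).eq

/-- An element commuting with all units that commute with a nontrivial idempotent `p` is a
combination of `p` and `1 - p`. -/
lemma exists_eq_smul_add_smul [IsSimpleRing S] {p V : S} (hp : IsIdempotentElem p)
    (hp0 : p ≠ 0) (hp1 : p ≠ 1) (hV : ∀ w : Sˣ, Commute (w : S) p → Commute V w) :
    ∃ α β : ℂ, V = α • p + β • (1 - p) := by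
  have key : ∀ r : S, IsIdempotentElem r → r ≠ 0 → (∀ y, Commute (r * y * r) p) →
      Commute r p → ∃ α : ℂ, V * r = α • r := by
    intro r hr hr0 hcomm hrp
    have hr' : r * r = r := hr
    have hVr : V * r = r * V := (commute_of_forall_units_commute hV hrp).eq
    refine exists_eq_smul_of_central_in_corner hr hr0 ?_ fun x => ?_
    · rw [hVr, ← mul_assoc, hr', ← hVr, mul_assoc, hr']
    · have h := (commute_of_forall_units_commute hV (hcomm x)).eq
      calc V * r * (r * x * r) = V * ((r * r) * x * r) := by simp only [mul_assoc]
        _ = r * x * (r * r) * V := by rw [hr', h]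
        _ = r * x * r * (V * r) := by rw [hVr]; simp only [mul_assoc]
  have hp' : p * p = p := hp
  obtain ⟨α, hα⟩ := key p hp hp0
    (fun y => by
      change _ * _ = _ * _
      simp only [← mul_assoc, hp']
      simp only [mul_assoc, hp']) (Commute.refl p)
  obtain ⟨β, hβ⟩ := key (1 - p) hp.one_sub (sub_ne_zero.2 hp1.symm)
    (fun y => by
      change _ * _ = _ * _
      have h1 : (1 - p) * p = 0 := by rw [sub_mul, hp', one_mul, sub_self]
      have h2 : p * (1 - p) = 0 := by rw [mul_sub, hp', mul_one, sub_self]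
      rw [mul_assoc, h1, mul_zero, ← mul_assoc, ← mul_assoc, h2, zero_mul, zero_mul])
    ((Commute.one_left p).sub_left (Commute.refl p))
  exact ⟨α, β, by rw [← hα, ← hβ, ← mul_add, add_sub_cancel, mul_one]⟩

end Corners

section Theta

variable {R S : Type*} [Ring R] [Ring S] [Algebra ℂ S]

lemma inv_two_smul_two_mul (x : S) : (2 : ℂ)⁻¹ • (2 * x) = x := by
  rw [two_mul, ← two_smul ℂ x, smul_smul]; norm_num

lemma two_mul_cancel {x y : S} (h : 2 * x = 2 * y) : x = y := by
  rw [← inv_two_smul_two_mul x, h, inv_two_smul_two_mul]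

lemma commute_one_sub_two_mul_iff {x p : S} : Commute x (1 - 2 * p) ↔ Commute x p := by
  refine ⟨fun h => ?_, fun h =>
    (Commute.one_right x).sub_right ((Commute.ofNat_right x 2).mul_right h)⟩
  have h' : x * (1 - 2 * p) = (1 - 2 * p) * x := h
  refine two_mul_cancel ?_
  linear_combination (norm := noncomm_ring) -h'

lemma coe_symUnit {R : Type*} [Ring R] {e : R} (he : IsIdempotentElem e) : (symUnit he : R) = 1 - 2 * e := rfl

lemma IsIdempotentElem.add_of_mul_eq_zero {R : Type*} [Ring R] {e f : R} (he : IsIdempotentElem e)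
    (hf : IsIdempotentElem f) (h1 : e * f = 0) (h2 : f * e = 0) : IsIdempotentElem (e + f) := by
  have he' : e * e = e := he
  have hf' : f * f = f := hf
  change (e + f) * (e + f) = e + f
  simp [mul_add, add_mul, he', hf', h1, h2]

variable (φ : Rˣ ≃* Sˣ)

lemma two_mul_theta {e : R} (he : IsIdempotentElem e) :
    2 * theta φ e = 1 - (φ (symUnit he) : S) := by
  rw [theta, dif_pos he, two_mul, ← add_smul]; norm_num

lemma coe_map_symUnit {e : R} (he : IsIdempotentElem e) :
    (φ (symUnit he) : S) = 1 - 2 * theta φ e := by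
  rw [two_mul_theta φ he, sub_sub_cancel]

lemma theta_of_map_symUnit {e : R} (he : IsIdempotentElem e) {p : S}
    (h : (φ (symUnit he) : S) = 1 - 2 * p) : theta φ e = p := by
  refine two_mul_cancel ?_
  rw [two_mul_theta φ he, h, sub_sub_cancel]

lemma theta_idem {e : R} (he : IsIdempotentElem e) : IsIdempotentElem (theta φ e) := by
  have h1 : symUnit he * symUnit he = 1 := Units.ext (symUnit he).val_inv
  have h2 : (φ (symUnit he) : S) * φ (symUnit he) = 1 := by
    rw [← Units.val_mul, ← map_mul, h1, map_one, Units.val_one]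
  rw [coe_map_symUnit] at h2
  refine two_mul_cancel (two_mul_cancel ?_)
  linear_combination (norm := noncomm_ring) h2

lemma theta_zero : theta φ (0 : R) = 0 := by
  have h0 : IsIdempotentElem (0 : R) := IsIdempotentElem.zero
  have h : symUnit h0 = 1 := Units.ext (by rw [coe_symUnit]; simp)
  refine two_mul_cancel ?_
  rw [two_mul_theta φ h0, h]; simp

lemma theta_conj {e : R} (he : IsIdempotentElem e) (u : Rˣ)
    (hu : IsIdempotentElem ((u : R) * e * (u⁻¹ : Rˣ))) :
    theta φ ((u : R) * e * (u⁻¹ : Rˣ)) = φ u * theta φ e * ((φ u)⁻¹ : Sˣ) := by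
  have h : symUnit hu = u * symUnit he * u⁻¹ := Units.ext (by
    rw [coe_symUnit, Units.val_mul, Units.val_mul, coe_symUnit, mul_sub, sub_mul, mul_one,
      Units.mul_inv]
    noncomm_ring)
  refine theta_of_map_symUnit φ hu ?_
  rw [h, map_mul, map_mul, map_inv, Units.val_mul, Units.val_mul, coe_map_symUnit, mul_sub,
    sub_mul, mul_one, Units.mul_inv]
  noncomm_ring

lemma theta_add {e f : R} (he : IsIdempotentElem e) (hf : IsIdempotentElem f)
    (h1 : e * f = 0) (h2 : f * e = 0) :
    theta φ (e + f) = theta φ e + theta φ f - 2 * (theta φ e * theta φ f) := by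
  have hs := he.add_of_mul_eq_zero hf h1 h2
  have h : symUnit hs = symUnit he * symUnit hf := Units.ext (by
    rw [Units.val_mul, coe_symUnit, coe_symUnit, coe_symUnit]
    linear_combination (norm := noncomm_ring) -4 * h1)
  refine theta_of_map_symUnit φ hs ?_
  rw [h, map_mul, Units.val_mul, coe_map_symUnit, coe_map_symUnit]
  noncomm_ring

variable [Algebra ℂ R]

lemma theta_inj {e f : R} (he : IsIdempotentElem e) (hf : IsIdempotentElem f)
    (h : theta φ e = theta φ f) : e = f := by
  have h1 : symUnit he = symUnit hf := φ.injective (Units.ext (by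
    rw [coe_map_symUnit, coe_map_symUnit, h]))
  have h2 := congrArg Units.val h1
  rw [coe_symUnit, coe_symUnit] at h2
  exact two_mul_cancel (sub_right_injective h2)

lemma commute_theta_iff {e : R} (he : IsIdempotentElem e) (w : Rˣ) :
    Commute (φ w : S) (theta φ e) ↔ Commute (w : R) e := by
  rw [← commute_one_sub_two_mul_iff (x := (φ w : S)),
    ← commute_one_sub_two_mul_iff (x := (w : R)), ← coe_map_symUnit φ he,
    ← coe_symUnit he, Commute.units_val_iff, Commute.units_val_iff]
  exact ⟨fun h => φ.injective (by simpa using h.eq), fun h => h.map φ⟩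

lemma theta_commute {e f : R} (he : IsIdempotentElem e) (hf : IsIdempotentElem f)
    (h : Commute e f) : Commute (theta φ e) (theta φ f) := by
  have h1 : Commute (φ (symUnit he) : S) (theta φ f) := by
    rw [commute_theta_iff φ hf, coe_symUnit]
    exact (Commute.one_left f).sub_left ((Commute.ofNat_left 2 f).mul_left h)
  rw [coe_map_symUnit] at h1
  have h' : (1 - 2 * theta φ e) * theta φ f = theta φ f * (1 - 2 * theta φ e) := h1
  refine two_mul_cancel ?_
  linear_combination (norm := noncomm_ring) -h'

end Theta

section Ratio

variable {R S : Type*} [Ring R] [Algebra ℂ R] [Nontrivial R]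
  [NormedRing S] [NormedAlgebra ℂ S] [CompleteSpace S] [IsSimpleRing S] (φ : Rˣ ≃* Sˣ)

lemma map_neg_one : (φ (-1) : S) = -1 := by
  have hcen : ∀ w : Sˣ, Commute (φ (-1) : S) w := by
    intro w
    obtain ⟨u, rfl⟩ := φ.surjective w
    rw [Commute.units_val_iff]
    exact (show Commute (-1) u from (Commute.one_left u).neg_left).map φ
  obtain ⟨α, hα⟩ := exists_eq_smul_one_of_central hcen
  have hsq : (φ (-1) : S) * φ (-1) = 1 := by
    rw [← Units.val_mul, ← map_mul]; simp
  have hne : (φ (-1) : S) ≠ 1 := by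
    intro h
    have h1 : φ (-1) = φ 1 := Units.ext (by rw [h]; simp)
    have h2 := congrArg Units.val (φ.injective h1)
    have h3 : (2 : R) * 1 = 2 * 0 := by
      simp only [Units.val_neg, Units.val_one] at h2
      linear_combination (norm := noncomm_ring) -h2
    exact one_ne_zero (two_mul_cancel h3)
  rw [hα] at hsq hne ⊢
  have h1 : (α * α - 1) • (1 : S) = 0 := by
    rw [smul_mul_smul_comm, mul_one] at hsq
    rw [sub_smul, one_smul, hsq, sub_self]
  rcases smul_eq_zero.1 h1 with h2 | h2
  · rcases mul_self_eq_one_iff.1 (sub_eq_zero.1 h2) with h3 | h3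
    · exact absurd (by rw [h3, one_smul]) hne
    · rw [h3, neg_smul, one_smul]
  · exact absurd h2 one_ne_zero

/-- Idempotents different from `0` and `1`. -/
def IsProperIdem {R : Type*} [Ring R] (e : R) : Prop := IsIdempotentElem e ∧ e ≠ 0 ∧ e ≠ 1

lemma IsProperIdem.one_sub {R : Type*} [Ring R] {e : R} (he : IsProperIdem e) :
    IsProperIdem (1 - e) :=
  ⟨he.1.one_sub, sub_ne_zero.2 he.2.2.symm, fun h => he.2.1 (by simpa using h)⟩

/-- The unit `l e + (1 - e)`. -/
def scaleUnit {R : Type*} [Ring R] [Algebra ℂ R] {e : R} (he : IsIdempotentElem e) : ℂˣ →* Rˣ :=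
  MonoidHom.toHomUnits
    { toFun := fun l => (l : ℂ) • e + 1 - e
      map_one' := by simp
      map_mul' := fun l m => by
        have he' : e * e = e := he
        simp only [Units.val_mul, mul_smul, add_mul, sub_mul, mul_add, mul_sub, smul_mul_assoc,
          mul_smul_comm, he', one_mul, mul_one, smul_sub, smul_add, smul_comm (m : ℂ)]
        abel }

lemma coe_scaleUnit {R : Type*} [Ring R] [Algebra ℂ R] {e : R} (he : IsIdempotentElem e) (l : ℂˣ) :
    (scaleUnit he l : R) = (l : ℂ) • e + 1 - e := rfl

lemma theta_one_sub {e : R} (he : IsIdempotentElem e) : theta φ (1 - e) = 1 - theta φ e := by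
  have h : symUnit he.one_sub = -1 * symUnit he := Units.ext (by
    rw [Units.val_mul, coe_symUnit, coe_symUnit]
    simp only [Units.val_neg, Units.val_one]
    noncomm_ring)
  refine theta_of_map_symUnit φ he.one_sub ?_
  rw [h, map_mul, Units.val_mul, map_neg_one, coe_map_symUnit]
  noncomm_ring

lemma IsProperIdem.theta {e : R} (he : IsProperIdem e) : IsProperIdem (theta φ e) := by
  refine ⟨theta_idem φ he.1, fun h => he.2.1 ?_, fun h => he.2.2 ?_⟩
  · exact theta_inj φ he.1 IsIdempotentElem.zero (by rw [h, theta_zero])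
  · have h1 : 1 - e = 0 := theta_inj φ he.1.one_sub IsIdempotentElem.zero (by
      rw [theta_zero, theta_one_sub φ he.1, h, sub_self])
    exact (sub_eq_zero.1 h1).symm

/-- Combinations of `p` and `1 - p` determine their coefficients. -/
lemma smul_add_smul_inj {S : Type*} [Ring S] [Algebra ℂ S] {p : S} (hp : IsProperIdem p) {a b a' b' : ℂ}
    (h : a • p + b • (1 - p) = a' • p + b' • (1 - p)) : a = a' ∧ b = b' := by
  have hp' : p * p = p := hp.1
  have h1 := congrArg (· * p) h
  have h2 := congrArg (· * (1 - p)) h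
  have hq : (1 - p) * (1 - p) = 1 - p := hp.1.one_sub
  have hqp : (1 - p) * p = 0 := by rw [sub_mul, hp', one_mul, sub_self]
  have hpq : p * (1 - p) = 0 := by rw [mul_sub, hp', mul_one, sub_self]
  simp only [add_mul, smul_mul_assoc, hp', hq, hqp, hpq, smul_zero, add_zero, zero_add] at h1 h2
  exact ⟨smul_left_injective ℂ hp.2.1 h1, smul_left_injective ℂ (sub_ne_zero.2 hp.2.2.symm) h2⟩

lemma smul_add_smul_mul {S : Type*} [Ring S] [Algebra ℂ S] {p : S} (hp : IsIdempotentElem p) (a b a' b' : ℂ) :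
    (a • p + b • (1 - p)) * (a' • p + b' • (1 - p)) = (a * a') • p + (b * b') • (1 - p) := by
  have hp' : p * p = p := hp
  simp only [add_mul, mul_add, smul_mul_smul_comm, sub_mul, mul_sub, mul_one, one_mul, hp',
    sub_self, sub_zero, smul_zero, add_zero, zero_add]

lemma exists_isCoeffMaps {e : R} (he : IsProperIdem e) :
    ∃ a b : ℂˣ →* ℂˣ, IsCoeffMaps φ e a b := by
  have hp := he.theta φ
  have key : ∀ l : ℂˣ, ∃ x : ℂ × ℂ,
      (φ (scaleUnit he.1 l) : S) = x.1 • theta φ e + x.2 • (1 - theta φ e) := by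
    intro l
    obtain ⟨α, β, h⟩ := exists_eq_smul_add_smul hp.1 hp.2.1 hp.2.2
      (V := (φ (scaleUnit he.1 l) : S)) fun w hw => by
        obtain ⟨u, rfl⟩ := φ.surjective w
        rw [commute_theta_iff φ he.1] at hw
        refine Commute.units_val (Commute.map (Commute.units_of_val ?_) φ)
        rw [coe_scaleUnit]
        exact ((hw.symm.smul_left _).add_left (Commute.one_left _)).sub_left hw.symm
    exact ⟨(α, β), h⟩
  choose x hx using key
  have h1 : (x 1).1 = 1 ∧ (x 1).2 = 1 := smul_add_smul_inj hp (by
    rw [← hx, map_one, map_one]; simp)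
  have hmul : ∀ l m, (x (l * m)).1 = (x l).1 * (x m).1 ∧ (x (l * m)).2 = (x l).2 * (x m).2 := by
    intro l m
    refine smul_add_smul_inj hp ?_
    rw [← hx, ← smul_add_smul_mul hp.1, ← hx, ← hx, map_mul, map_mul, Units.val_mul]
  refine ⟨MonoidHom.toHomUnits ⟨⟨fun l => (x l).1, h1.1⟩, fun l m => (hmul l m).1⟩,
    MonoidHom.toHomUnits ⟨⟨fun l => (x l).2, h1.2⟩, fun l m => (hmul l m).2⟩, ?_⟩
  intro l v hv
  have : v = scaleUnit he.1 l := Units.ext hv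
  rw [this, hx, theta_one_sub φ he.1]
  rfl

lemma isCoeffMaps_iff {e : R} (he : IsIdempotentElem e) {a b : ℂˣ →* ℂˣ} :
    IsCoeffMaps φ e a b ↔ ∀ l, (φ (scaleUnit he l) : S) =
      (a l : ℂ) • theta φ e + (b l : ℂ) • (1 - theta φ e) := by
  rw [← theta_one_sub φ he]
  refine ⟨fun h l => h l _ rfl, fun h l v hv => ?_⟩
  rw [show v = scaleUnit he l from Units.ext hv, h]

lemma IsCoeffMaps.unique {e : R} (he : IsProperIdem e) {a b a' b' : ℂˣ →* ℂˣ}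
    (h : IsCoeffMaps φ e a b) (h' : IsCoeffMaps φ e a' b') : a = a' ∧ b = b' := by
  rw [isCoeffMaps_iff φ he.1] at h h'
  have key := fun l => smul_add_smul_inj (he.theta φ) ((h l).symm.trans (h' l))
  exact ⟨MonoidHom.ext fun l => Units.ext (key l).1, MonoidHom.ext fun l => Units.ext (key l).2⟩

open Classical in
/-- The quotient of the coefficient maps of an idempotent. -/
def ratio (e : R) : ℂˣ →* ℂˣ :=
  if h : ∃ c : ℂˣ →* ℂˣ, ∃ a b : ℂˣ →* ℂˣ, IsCoeffMaps φ e a b ∧ c = a / b then h.choose else 1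

lemma IsCoeffMaps.ratio_eq {e : R} (he : IsProperIdem e) {a b : ℂˣ →* ℂˣ}
    (h : IsCoeffMaps φ e a b) : ratio φ e = a / b := by
  have hex : ∃ c : ℂˣ →* ℂˣ, ∃ a b : ℂˣ →* ℂˣ, IsCoeffMaps φ e a b ∧ c = a / b := ⟨_, a, b, h, rfl⟩
  obtain ⟨a', b', h', hc⟩ := hex.choose_spec
  obtain ⟨rfl, rfl⟩ := h.unique φ he h'
  rw [ratio, dif_pos hex, hc]

lemma cEquiv_iff {e f : R} (he : IsProperIdem e) (hf : IsProperIdem f) :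
    cEquiv φ e f ↔ ratio φ e = ratio φ f := by
  constructor
  · rintro ⟨a, b, a', b', h, h', hc⟩
    rw [h.ratio_eq φ he, h'.ratio_eq φ hf]
    ext1 l
    simpa [cOf, div_eq_mul_inv] using hc l
  · intro hr
    obtain ⟨a, b, h⟩ := exists_isCoeffMaps φ he
    obtain ⟨a', b', h'⟩ := exists_isCoeffMaps φ hf
    refine ⟨a, b, a', b', h, h', fun l => ?_⟩
    rw [h.ratio_eq φ he, h'.ratio_eq φ hf] at hr
    simpa [cOf, div_eq_mul_inv] using DFunLike.congr_fun hr l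

lemma ratio_ne_inv {e : R} (he : IsProperIdem e) : ratio φ e ≠ (ratio φ e)⁻¹ := by
  obtain ⟨a, b, h⟩ := exists_isCoeffMaps φ he
  have hneg : (a (-1) : ℂ) = -1 ∧ (b (-1) : ℂ) = 1 := by
    refine smul_add_smul_inj (he.theta φ) ?_
    rw [← (isCoeffMaps_iff φ he.1).1 h, show scaleUnit he.1 (-1) = symUnit he.1 from
      Units.ext (by rw [coe_scaleUnit, coe_symUnit]; simp; noncomm_ring), coe_map_symUnit]
    simp
    noncomm_ring
  have h1 : a (-1) = -1 := Units.ext (by simpa using hneg.1)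
  have h2 : b (-1) = 1 := Units.ext (by simpa using hneg.2)
  intro hc
  let i : ℂˣ := Units.mk0 Complex.I Complex.I_ne_zero
  have hi : i * i = -1 := Units.ext (by simp [i])
  have h3 : ratio φ e (i * i) = 1 := by
    rw [map_mul]
    nth_rewrite 1 [hc]
    simp
  rw [hi, h.ratio_eq φ he, MonoidHom.div_apply, h1, h2, div_one] at h3
  have h4 := congrArg Units.val h3
  norm_num at h4

lemma IsProperIdem.conj {R : Type*} [Ring R] {e : R} (he : IsProperIdem e) (u : Rˣ) :
    IsProperIdem ((u : R) * e * (u⁻¹ : Rˣ)) := by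
  have he' : e * e = e := he.1
  refine ⟨?_, fun h => he.2.1 ?_, fun h => he.2.2 ?_⟩
  · change _ * _ = _
    calc (u : R) * e * (u⁻¹ : Rˣ) * ((u : R) * e * (u⁻¹ : Rˣ))
        = u * (e * e) * (u⁻¹ : Rˣ) := by simp only [mul_assoc, Units.inv_mul_cancel_left]
      _ = _ := by rw [he']
  · simpa using h
  · rw [Units.mul_inv_eq_iff_eq_mul, one_mul] at h
    exact u.isUnit.mul_left_cancel (h.trans (mul_one _).symm)

lemma ratio_conj {e : R} (he : IsProperIdem e) (u : Rˣ) :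
    ratio φ ((u : R) * e * (u⁻¹ : Rˣ)) = ratio φ e := by
  obtain ⟨a, b, h⟩ := exists_isCoeffMaps φ he
  have hu := he.conj u
  rw [h.ratio_eq φ he]
  refine IsCoeffMaps.ratio_eq φ hu ?_
  rw [isCoeffMaps_iff φ he.1] at h
  rw [isCoeffMaps_iff φ hu.1]
  intro l
  have h1 : scaleUnit hu.1 l = u * scaleUnit he.1 l * u⁻¹ := Units.ext (by
    simp [coe_scaleUnit, mul_add, add_mul, mul_sub, sub_mul])
  rw [h1, map_mul, map_mul, map_inv, Units.val_mul, Units.val_mul, h, theta_conj φ he.1 u hu.1]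
  simp [mul_add, add_mul, mul_sub, sub_mul]

lemma ratio_one_sub {e : R} (he : IsProperIdem e) : ratio φ (1 - e) = ratio φ e := by
  obtain ⟨a, b, h⟩ := exists_isCoeffMaps φ he
  obtain ⟨a', b', h'⟩ := exists_isCoeffMaps φ he.one_sub
  rw [h.ratio_eq φ he, h'.ratio_eq φ he.one_sub]
  rw [isCoeffMaps_iff φ he.1] at h
  rw [isCoeffMaps_iff φ he.one_sub.1, theta_one_sub φ he.1, sub_sub_cancel] at h'
  ext1 l
  rw [MonoidHom.div_apply, MonoidHom.div_apply, div_eq_div_iff_mul_eq_mul]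
  ext1
  have hcen : ∀ w : Sˣ, Commute (φ (scaleUnit he.1 l * scaleUnit he.one_sub.1 l) : S) w := by
    intro w
    obtain ⟨u, rfl⟩ := φ.surjective w
    refine Commute.units_val (Commute.map (Commute.units_of_val ?_) φ)
    have h1 : ((scaleUnit he.1 l * scaleUnit he.one_sub.1 l : Rˣ) : R) = (l : ℂ) • (1 : R) := by
      have he' : e * e = e := he.1
      rw [Units.val_mul, coe_scaleUnit, coe_scaleUnit]
      simp only [add_mul, sub_mul, mul_add, mul_sub, smul_mul_assoc,
          mul_smul_comm, he', one_mul, mul_one, smul_sub, smul_add]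
      abel
    rw [h1]
    exact (Commute.one_left _).smul_left _
  obtain ⟨α, hα⟩ := exists_eq_smul_one_of_central hcen
  rw [map_mul, Units.val_mul, h, h', add_comm ((a' l : ℂ) • _),
    smul_add_smul_mul (theta_idem φ he.1)] at hα
  have h2 := smul_add_smul_inj (he.theta φ) (a' := α) (b' := α)
    (hα.trans (by rw [← smul_add, add_sub_cancel]))
  change (a' l : ℂ) * b l = a l * b' l
  rw [h2.1, mul_comm, h2.2]

/-- Two idempotents with product zero in either order. -/
def Orthogonal {R : Type*} [Ring R] (e f : R) : Prop := e * f = 0 ∧ f * e = 0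

lemma IsProperIdem.add {R : Type*} [Ring R] {e f : R} (he : IsProperIdem e) (hf : IsProperIdem f)
    (h : Orthogonal e f) (h1 : e + f ≠ 1) : IsProperIdem (e + f) := by
  refine ⟨he.1.add_of_mul_eq_zero hf.1 h.1 h.2, fun h0 => he.2.1 ?_, h1⟩
  have he' : e * e = e := he.1
  have := congrArg (e * ·) h0
  simpa [mul_add, he', h.1] using this

lemma monoidHom_div_eq_div_iff {G H : Type*} [MulOneClass G] [CommGroup H] {a b c d : G →* H} :
    a / b = c / d ↔ a * d = c * b := by
  simp only [DFunLike.ext_iff, MonoidHom.div_apply, MonoidHom.mul_apply, div_eq_div_iff_mul_eq_mul]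

lemma monoidHom_inv_div {G H : Type*} [MulOneClass G] [CommGroup H] (a b : G →* H) :
    (a / b)⁻¹ = b / a := by
  ext1
  simp

/-- Comparing coefficients on the four atoms generated by two commuting idempotents. -/
lemma atoms_smul_eq_zero {S : Type*} [Ring S] [Algebra ℂ S] {p q : S} (hp : IsIdempotentElem p)
    (hq : IsIdempotentElem q) (hpq : Commute p q) {α β γ δ : ℂ}
    (h : α • (p * q) + β • (p * (1 - q)) + γ • ((1 - p) * q) + δ • ((1 - p) * (1 - q)) = 0) :
    α • (p * q) = 0 ∧ β • (p * (1 - q)) = 0 ∧ γ • ((1 - p) * q) = 0 ∧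
      δ • ((1 - p) * (1 - q)) = 0 := by
  have hcross : ∀ p p' q q' : S, Commute p' q → (p * q) * (p' * q') = (p * p') * (q * q') :=
    fun p p' q q' h => h.symm.mul_mul_mul_comm p q'
  have hp0 : p * (1 - p) = 0 := hp.mul_one_sub_self
  have hp0' : (1 - p) * p = 0 := hp.one_sub_mul_self
  have hq0 : q * (1 - q) = 0 := hq.mul_one_sub_self
  have hq0' : (1 - q) * q = 0 := hq.one_sub_mul_self
  have hc1 : Commute (1 - p) q := (Commute.one_left q).sub_left hpq
  have hc2 : Commute p (1 - q) := (Commute.one_right p).sub_right hpq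
  have hc3 : Commute (1 - p) (1 - q) := (Commute.one_left _).sub_left hc2
  refine ⟨?_, ?_, ?_, ?_⟩
  · have := congrArg (p * q * ·) h
    simpa only [mul_add, mul_smul_comm, hcross _ _ _ _ hpq, hcross _ _ _ _ hc1, hp.eq, hq.eq, hp0,
      hq0, mul_zero, zero_mul, smul_zero, add_zero] using this
  · have := congrArg (p * (1 - q) * ·) h
    simpa only [mul_add, mul_smul_comm, hcross _ _ _ _ hc2, hcross _ _ _ _ hc3, hp.eq,
      hq.one_sub.eq, hp0, hq0', mul_zero, zero_mul, smul_zero, add_zero, zero_add] using this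
  · have := congrArg ((1 - p) * q * ·) h
    simpa only [mul_add, mul_smul_comm, hcross _ _ _ _ hpq, hcross _ _ _ _ hc1, hp.one_sub.eq,
      hq.eq, hp0', hq0, mul_zero, zero_mul, smul_zero, add_zero, zero_add] using this
  · have := congrArg ((1 - p) * (1 - q) * ·) h
    simpa only [mul_add, mul_smul_comm, hcross _ _ _ _ hc2, hcross _ _ _ _ hc3, hp.one_sub.eq,
      hq.one_sub.eq, hp0', hq0', mul_zero, zero_mul, smul_zero, add_zero, zero_add] using this

/-- The four possible behaviours of `θ` and of the ratios on an orthogonal pair. -/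
lemma orthogonal_pair_cases {e f : R} (he : IsProperIdem e) (hf : IsProperIdem f)
    (h : Orthogonal e f) (h1 : e + f ≠ 1) :
    (ratio φ e = ratio φ f ∧ ratio φ (e + f) = ratio φ f ∧ theta φ e * theta φ f = 0) ∨
    (ratio φ e = ratio φ f ∧ ratio φ (e + f) = (ratio φ f)⁻¹ ∧
      (1 - theta φ e) * (1 - theta φ f) = 0) ∨
    (ratio φ e = (ratio φ f)⁻¹ ∧ ratio φ (e + f) = ratio φ e ∧
      (1 - theta φ e) * theta φ f = 0) ∨
    (ratio φ e = (ratio φ f)⁻¹ ∧ ratio φ (e + f) = ratio φ f ∧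
      theta φ e * (1 - theta φ f) = 0) := by
  have hs := he.add hf h h1
  obtain ⟨a₁, b₁, hc₁⟩ := exists_isCoeffMaps φ he
  obtain ⟨a₂, b₂, hc₂⟩ := exists_isCoeffMaps φ hf
  obtain ⟨a₃, b₃, hc₃⟩ := exists_isCoeffMaps φ hs
  rw [hc₁.ratio_eq φ he, hc₂.ratio_eq φ hf]
  have hsne := ratio_ne_inv φ hs
  rw [hc₃.ratio_eq φ hs] at hsne ⊢
  rw [isCoeffMaps_iff φ he.1] at hc₁
  rw [isCoeffMaps_iff φ hf.1] at hc₂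
  rw [isCoeffMaps_iff φ hs.1, theta_add φ he.1 hf.1 h.1 h.2] at hc₃
  have hprod : ∀ l, scaleUnit he.1 l * scaleUnit hf.1 l = scaleUnit hs.1 l := fun l =>
    Units.ext (by
      rw [Units.val_mul, coe_scaleUnit, coe_scaleUnit, coe_scaleUnit]
      simp only [add_mul, sub_mul, mul_add, mul_sub, smul_mul_assoc, mul_smul_comm, h.1, one_mul,
        mul_one, smul_add, smul_zero]
      abel)
  have hcomm := theta_commute φ he.1 hf.1 (h.1.trans h.2.symm)
  have hnef : theta φ e ≠ theta φ f := fun h0 => he.2.1 (by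
    have h2 := h.1
    rw [← theta_inj φ he.1 hf.1 h0] at h2
    rw [← he.1.eq, h2])
  have hnef' : theta φ e + theta φ f ≠ 1 := fun h0 => h1 (by
    rw [theta_inj φ he.1 hf.one_sub.1 (by rw [theta_one_sub φ hf.1, ← h0, add_sub_cancel_right]),
      sub_add_cancel])
  have hpn := (he.theta φ).2
  have hqn := (hf.theta φ).2
  have hpp := theta_idem φ he.1
  have hqq := theta_idem φ hf.1
  generalize theta φ e = p at *
  generalize theta φ f = q at *
  have heq : ∀ l, ((a₁ l : ℂ) • p + (b₁ l : ℂ) • (1 - p)) * ((a₂ l : ℂ) • q + (b₂ l : ℂ) • (1 - q)) =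
      (a₃ l : ℂ) • (p + q - 2 * (p * q)) + (b₃ l : ℂ) • (1 - (p + q - 2 * (p * q))) := fun l => by
    rw [← hc₁, ← hc₂, ← hc₃, ← hprod, map_mul, Units.val_mul]
  have hatoms : ∀ l, _ := fun l => atoms_smul_eq_zero hpp hqq hcomm
    (α := a₁ l * a₂ l - b₃ l) (β := a₁ l * b₂ l - a₃ l) (γ := b₁ l * a₂ l - a₃ l)
    (δ := b₁ l * b₂ l - b₃ l) (by
      have hr : p + q - 2 * (p * q) = p * (1 - q) + (1 - p) * q := by noncomm_ring
      have hr' : 1 - (p + q - 2 * (p * q)) = p * q + (1 - p) * (1 - q) := by noncomm_ring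
      have h0 := heq l
      rw [hr', hr, mul_add, add_mul, add_mul, smul_mul_smul_comm, smul_mul_smul_comm,
        smul_mul_smul_comm, smul_mul_smul_comm, smul_add, smul_add] at h0
      rw [sub_smul, sub_smul, sub_smul, sub_smul, ← sub_eq_zero.2 h0]
      abel)
  have hzero : ∀ (x : S) (u v : ℂˣ →* ℂˣ), x ≠ 0 →
      (∀ l, ((u l : ℂ) - v l) • x = 0) → u = v := fun x u v hx huv =>
    MonoidHom.ext fun l => Units.ext (sub_eq_zero.1 ((smul_eq_zero.1 (huv l)).resolve_right hx))
  have hx : p * q ≠ 0 → a₁ * a₂ = b₃ := fun h0 =>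
    hzero _ _ _ h0 fun l => (hatoms l).1
  have hy : p * (1 - q) ≠ 0 → a₁ * b₂ = a₃ := fun h0 =>
    hzero _ _ _ h0 fun l => (hatoms l).2.1
  have hz : (1 - p) * q ≠ 0 → b₁ * a₂ = a₃ := fun h0 =>
    hzero _ _ _ h0 fun l => (hatoms l).2.2.1
  have hw : (1 - p) * (1 - q) ≠ 0 → b₁ * b₂ = b₃ := fun h0 =>
    hzero _ _ _ h0 fun l => (hatoms l).2.2.2
  have hxy : p * q = 0 → p * (1 - q) ≠ 0 := fun h2 h3 => hpn.1 (by
    linear_combination (norm := noncomm_ring) h2 + h3)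
  have hxz : p * q = 0 → (1 - p) * q ≠ 0 := fun h2 h3 => hqn.1 (by
    linear_combination (norm := noncomm_ring) h2 + h3)
  have hxw : p * q = 0 → (1 - p) * (1 - q) ≠ 0 := fun h2 h3 => hnef' (by
    linear_combination (norm := noncomm_ring) h2 - h3)
  have hyz : p * (1 - q) = 0 → (1 - p) * q ≠ 0 := fun h2 h3 => hnef (by
    linear_combination (norm := noncomm_ring) h2 - h3)
  have hyw : p * (1 - q) = 0 → (1 - p) * (1 - q) ≠ 0 := fun h2 h3 => hqn.2 (by
    linear_combination (norm := noncomm_ring) -h2 - h3)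
  have hzw : (1 - p) * q = 0 → (1 - p) * (1 - q) ≠ 0 := fun h2 h3 => hpn.2 (by
    linear_combination (norm := noncomm_ring) -h2 - h3)
  by_cases x0 : p * q = 0
  · have h2 := hy (hxy x0)
    have h3 := hz (hxz x0)
    have h4 := hw (hxw x0)
    refine Or.inl ⟨?_, ?_, x0⟩
    · rw [monoidHom_div_eq_div_iff, h2, ← h3, mul_comm]
    · rw [monoidHom_div_eq_div_iff, ← h3, ← h4]
      ac_rfl
  by_cases w0 : (1 - p) * (1 - q) = 0
  · have h1 := hx x0
    have h2 := hy fun h => hyw h w0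
    have h3 := hz fun h => hzw h w0
    refine Or.inr (Or.inl ⟨?_, ?_, w0⟩)
    · rw [monoidHom_div_eq_div_iff, h2, ← h3, mul_comm]
    · rw [monoidHom_inv_div, monoidHom_div_eq_div_iff, ← h2, ← h1]
      ac_rfl
  by_cases z0 : (1 - p) * q = 0
  · have h1 := hx x0
    have h2 := hy fun h => hyz h z0
    have h4 := hw w0
    refine Or.inr (Or.inr (Or.inl ⟨?_, ?_, z0⟩))
    · rw [monoidHom_inv_div, monoidHom_div_eq_div_iff, h1, ← h4, mul_comm]
    · rw [monoidHom_div_eq_div_iff, ← h2, ← h4]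
      ac_rfl
  by_cases y0 : p * (1 - q) = 0
  · have h1 := hx x0
    have h3 := hz z0
    have h4 := hw w0
    refine Or.inr (Or.inr (Or.inr ⟨?_, ?_, y0⟩))
    · rw [monoidHom_inv_div, monoidHom_div_eq_div_iff, h1, ← h4, mul_comm]
    · rw [monoidHom_div_eq_div_iff, ← h3, ← h4]
      ac_rfl
  refine absurd ?_ hsne
  rw [monoidHom_inv_div, monoidHom_div_eq_div_iff]
  nth_rewrite 1 [← hy y0]
  rw [← hz z0, ← hx x0]
  nth_rewrite 1 [hx x0]
  rw [← hw w0]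
  ac_rfl

lemma monoidHom_inv_inv {G H : Type*} [MulOneClass G] [CommGroup H] (a : G →* H) :
    a⁻¹⁻¹ = a := by
  ext1
  simp

lemma Orthogonal.symm {R : Type*} [Ring R] {e f : R} (h : Orthogonal e f) : Orthogonal f e :=
  ⟨h.2, h.1⟩

lemma Orthogonal.add_left {R : Type*} [Ring R] {e f g : R} (h : Orthogonal e g)
    (h' : Orthogonal f g) : Orthogonal (e + f) g :=
  ⟨by rw [add_mul, h.1, h'.1, add_zero], by rw [mul_add, h.2, h'.2, add_zero]⟩

lemma IsProperIdem.ne_of_orthogonal {R : Type*} [Ring R] {e f : R} (he : IsProperIdem e)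
    (h : Orthogonal e f) : e ≠ f := by
  rintro rfl
  exact he.2.1 (he.1.eq.symm.trans h.1)

/-- A sum orthogonal to a nonzero element is different from `1`. -/
lemma IsProperIdem.ne_one_of_orthogonal {R : Type*} [Ring R] {e f : R} (he : IsProperIdem e)
    (h : Orthogonal f e) : f ≠ 1 := by
  rintro rfl
  exact he.2.1 (by simpa using h.1)

lemma IsProperIdem.sub_of_le {R : Type*} [Ring R] {e g : R} (hg : IsProperIdem g)
    (he : IsProperIdem e) (h1 : g * e = g) (h2 : e * g = g) (hne : g ≠ e) :
    IsProperIdem (e - g) ∧ Orthogonal g (e - g) := by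
  have hg' : g * g = g := hg.1
  have he' : e * e = e := he.1
  have ho : Orthogonal g (e - g) :=
    ⟨by rw [mul_sub, h1, hg', sub_self], by rw [sub_mul, h2, hg', sub_self]⟩
  refine ⟨⟨?_, sub_ne_zero.2 hne.symm, hg.ne_one_of_orthogonal ho.symm⟩, ho⟩
  change _ * _ = _
  rw [mul_sub, sub_mul, sub_mul, he', h1, h2, hg', sub_self, sub_zero]

lemma ratio_add_or {e f : R} (he : IsProperIdem e) (hf : IsProperIdem f)
    (h : Orthogonal e f) (h1 : e + f ≠ 1) :
    (ratio φ e = ratio φ (e + f) ∨ ratio φ e = (ratio φ (e + f))⁻¹) := by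
  rcases orthogonal_pair_cases φ he hf h h1 with h | h | h | h
  · exact Or.inl (h.1.trans h.2.1.symm)
  · right; rw [h.1, h.2.1, monoidHom_inv_inv]
  · exact Or.inl h.2.1.symm
  · right; rw [h.1, h.2.1]

lemma orthogonal_same_cases {e f : R} (he : IsProperIdem e) (hf : IsProperIdem f)
    (h : Orthogonal e f) (h1 : e + f ≠ 1) (hr : ratio φ e = ratio φ f) :
    (ratio φ (e + f) = ratio φ f ∧ theta φ e * theta φ f = 0) ∨
    (ratio φ (e + f) = (ratio φ f)⁻¹ ∧ (1 - theta φ e) * (1 - theta φ f) = 0) := by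
  have hne := ratio_ne_inv φ hf
  rcases orthogonal_pair_cases φ he hf h h1 with h | h | h | h
  · exact Or.inl h.2
  · exact Or.inr h.2
  · exact absurd (hr.symm.trans h.1) hne
  · exact absurd (hr.symm.trans h.1) hne

lemma ratio_add_eq_iff {e f : R} (he : IsProperIdem e) (hf : IsProperIdem f)
    (h : Orthogonal e f) (h1 : e + f ≠ 1) (hr : ratio φ e = ratio φ f) :
    ratio φ (e + f) = ratio φ f ↔ theta φ e * theta φ f = 0 := by
  refine ⟨fun h2 => ?_, fun h2 => ?_⟩
  · rcases orthogonal_same_cases φ he hf h h1 hr with h3 | h3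
    · exact h3.2
    · exact absurd (h2.symm.trans h3.1) (ratio_ne_inv φ hf)
  · rcases orthogonal_same_cases φ he hf h h1 hr with h3 | h3
    · exact h3.1
    · refine absurd ?_ h1
      have h4 : e = 1 - f := theta_inj φ he.1 hf.one_sub.1 (by
        rw [theta_one_sub φ hf.1]
        linear_combination (norm := noncomm_ring) h2 - h3.2)
      rw [h4, sub_add_cancel]

lemma ratio_add_eq_inv_iff {e f : R} (he : IsProperIdem e) (hf : IsProperIdem f)
    (h : Orthogonal e f) (h1 : e + f ≠ 1) (hr : ratio φ e = ratio φ f) :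
    ratio φ (e + f) = (ratio φ f)⁻¹ ↔ (1 - theta φ e) * (1 - theta φ f) = 0 := by
  refine ⟨fun h2 => ?_, fun h2 => ?_⟩
  · rcases orthogonal_same_cases φ he hf h h1 hr with h3 | h3
    · exact absurd (h3.1.symm.trans h2) (ratio_ne_inv φ hf)
    · exact h3.2
  · rcases orthogonal_same_cases φ he hf h h1 hr with h3 | h3
    · refine absurd ?_ h1
      have h4 : e = 1 - f := theta_inj φ he.1 hf.one_sub.1 (by
        rw [theta_one_sub φ hf.1]
        linear_combination (norm := noncomm_ring) h3.2 - h2)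
      rw [h4, sub_add_cancel]
    · exact h3.1

/-- Among three orthogonal idempotents with equal ratios, `θ` cannot preserve the orthogonality of
one pair and flip that of another. -/
lemma not_preserve_and_flip {e f g : R} (hf : IsProperIdem f)
    (hg : IsProperIdem g) (hfg : Orthogonal f g) (h1 : f + g ≠ 1)
    (hrg : ratio φ f = ratio φ g) (hfe : theta φ f * theta φ e = 0)
    (heg : (1 - theta φ e) * (1 - theta φ g) = 0) : False := by
  have hle : theta φ f * (1 - theta φ g) = 0 := by
    linear_combination (norm := noncomm_ring) theta φ f * heg + hfe * (1 - theta φ g)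
  rcases orthogonal_same_cases φ hf hg hfg h1 hrg with h2 | h2
  · exact (hf.theta φ).2.1 (by linear_combination (norm := noncomm_ring) hle + h2.2)
  · exact (hg.theta φ).2.2 (by linear_combination (norm := noncomm_ring) -hle - h2.2)

/-- A proper sum of three orthogonal idempotents with equal ratios has the same ratio. -/
lemma ratio_add_three {e f g : R} (he : IsProperIdem e) (hf : IsProperIdem f)
    (hg : IsProperIdem g) (hef : Orthogonal e f) (heg : Orthogonal e g) (hfg : Orthogonal f g)
    (h1 : e + f + g ≠ 1) (hre : ratio φ e = ratio φ g) (hrf : ratio φ f = ratio φ g) :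
    ratio φ (e + f + g) = ratio φ g := by
  have hef_g := heg.add_left hfg
  have hef1 : e + f ≠ 1 := hg.ne_one_of_orthogonal hef_g
  have heg1 : e + g ≠ 1 := hf.ne_one_of_orthogonal (hef.add_left hfg.symm)
  have hfg1 : f + g ≠ 1 := he.ne_one_of_orthogonal (hef.symm.add_left heg.symm)
  have hpef := he.add hf hef hef1
  have hs := hpef.add hg hef_g h1
  have hθef := theta_add φ he.1 hf.1 hef.1 hef.2
  have hθs := theta_add φ hpef.1 hg.1 hef_g.1 hef_g.2
  have cef := (theta_commute φ he.1 hf.1 (hef.1.trans hef.2.symm)).eq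
  have ceg := (theta_commute φ he.1 hg.1 (heg.1.trans heg.2.symm)).eq
  have cfg := (theta_commute φ hf.1 hg.1 (hfg.1.trans hfg.2.symm)).eq
  rcases orthogonal_same_cases φ he hf hef hef1 (hre.trans hrf.symm) with ⟨r12, t12⟩ | ⟨r12, t12⟩
  · rcases orthogonal_same_cases φ he hg heg heg1 hre with ⟨-, t13⟩ | ⟨-, t13⟩
    · rcases orthogonal_same_cases φ hf hg hfg hfg1 hrf with ⟨-, t23⟩ | ⟨-, t23⟩
      · rcases orthogonal_same_cases φ hpef hg hef_g h1 (r12.trans hrf) with h2 | h2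
        · exact h2.1
        · refine absurd ?_ (hs.theta φ).2.2
          have h3 := h2.2
          rw [hθef] at h3
          rw [hθs, hθef]
          linear_combination (norm := noncomm_ring) -h3 - t13 - t23 + 2 * t12 * theta φ g
      · exact (not_preserve_and_flip φ he hg heg heg1 hre t12 t23).elim
    · exact (not_preserve_and_flip φ hf hg hfg hfg1 hrf (cef.symm.trans t12) t13).elim
  · rcases orthogonal_same_cases φ he hg heg heg1 hre with ⟨-, t13⟩ | ⟨-, t13⟩
    · exact (not_preserve_and_flip φ hg hf hfg.symm (by rwa [add_comm]) hrf.symm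
        (ceg.symm.trans t13) t12).elim
    · rcases orthogonal_same_cases φ hf hg hfg hfg1 hrf with ⟨-, t23⟩ | ⟨-, t23⟩
      · refine (not_preserve_and_flip φ (e := f) hg he heg.symm (by rwa [add_comm]) hre.symm
          (cfg.symm.trans t23) ?_).elim
        linear_combination (norm := noncomm_ring) t12 - cef
      · rw [hrf] at r12
        rcases orthogonal_pair_cases φ hpef hg hef_g h1 with h2 | h2 | h2 | h2
        · exact absurd (h2.1.symm.trans r12) (ratio_ne_inv φ hg)
        · exact absurd (h2.1.symm.trans r12) (ratio_ne_inv φ hg)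
        · refine absurd (theta_inj φ hpef.1 hg.1 ?_) (hpef.ne_of_orthogonal hef_g)
          have h3 := h2.2.2
          rw [hθef] at h3 ⊢
          linear_combination (norm := noncomm_ring)
            -h3 + t13 + t23 + 2 * t12 * theta φ g - 2 * t12
        · exact h2.2.1

lemma ratio_of_le {e g : R} (he : IsProperIdem e) (hg : IsProperIdem g) (h1 : g * e = g)
    (h2 : e * g = g) (hne : g ≠ e) : ratio φ g = ratio φ e ∨ ratio φ g = (ratio φ e)⁻¹ := by
  obtain ⟨hp, ho⟩ := hg.sub_of_le he h1 h2 hne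
  have h := ratio_add_or φ hg hp ho
  rw [add_sub_cancel] at h
  exact h he.2.2

/-- A proper sum of an odd number of orthogonal idempotents with equal ratios has the same ratio. -/
lemma ratio_sum_odd {c : ℂˣ →* ℂˣ} (m : ℕ) (g : Fin (2 * m + 1) → R)
    (hg : ∀ i, IsProperIdem (g i)) (ho : ∀ i j, i ≠ j → g i * g j = 0)
    (hc : ∀ i, ratio φ (g i) = c) (h1 : ∑ i, g i ≠ 1) :
    IsProperIdem (∑ i, g i) ∧ ratio φ (∑ i, g i) = c := by
  induction m with
  | zero =>
    have : ∑ i, g i = g 0 := Fin.sum_univ_one g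
    rw [this]
    exact ⟨hg 0, hc 0⟩
  | succ m ih =>
    let x : Fin (2 * m + 1) → R := fun i => g i.castSucc.castSucc
    let y := g (Fin.last (2 * m + 1)).castSucc
    let z := g (Fin.last (2 * m + 2))
    have hsum : ∑ i, g i = ∑ i, x i + y + z :=
      (Fin.sum_univ_castSucc g).trans
        (congrArg (· + z) (Fin.sum_univ_castSucc fun i : Fin (2 * m + 2) => g i.castSucc))
    have hxy : ∀ i, Orthogonal (x i) y := fun i => by
      have hne : i.castSucc.castSucc ≠ (Fin.last (2 * m + 1)).castSucc := by simp
      exact ⟨ho _ _ hne, ho _ _ hne.symm⟩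
    have hxz : ∀ i, Orthogonal (x i) z := fun i => by
      have hne := (Fin.castSucc_lt_last i.castSucc).ne
      exact ⟨ho _ _ hne, ho _ _ hne.symm⟩
    have hyz : Orthogonal y z := by
      have hne := (Fin.castSucc_lt_last (Fin.last (2 * m + 1))).ne
      exact ⟨ho _ _ hne, ho _ _ hne.symm⟩
    have hXy : Orthogonal (∑ i, x i) y :=
      ⟨by rw [Finset.sum_mul]; exact Finset.sum_eq_zero fun i _ => (hxy i).1,
        by rw [Finset.mul_sum]; exact Finset.sum_eq_zero fun i _ => (hxy i).2⟩
    have hXz : Orthogonal (∑ i, x i) z :=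
      ⟨by rw [Finset.sum_mul]; exact Finset.sum_eq_zero fun i _ => (hxz i).1,
        by rw [Finset.mul_sum]; exact Finset.sum_eq_zero fun i _ => (hxz i).2⟩
    have hy : IsProperIdem y := hg _
    have hz : IsProperIdem z := hg _
    obtain ⟨hX, hXc⟩ := ih x (fun i => hg _)
      (fun i j hij => ho _ _ (by simpa using hij)) (fun i => hc _) (hy.ne_one_of_orthogonal hXy)
    rw [hsum] at h1 ⊢
    have hz' : ratio φ z = c := hc _
    have hy' : ratio φ y = c := hc _
    refine ⟨(hX.add hy hXy (hz.ne_one_of_orthogonal (hXz.add_left hyz))).add hz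
      (hXz.add_left hyz) h1, ?_⟩
    rw [ratio_add_three φ hX hy hz hXy hXz hyz h1 (hXc.trans hz'.symm) (hy'.trans hz'.symm), hz']

/-- If every proper subidempotent of `g` has the same ratio as `g`, then all idempotents have the
same ratio. -/
lemma ratio_eq_of_forall_le (hR : OddlyDecomposable R) {e g : R} (hg : IsProperIdem g)
    (he : IsProperIdem e)
    (h : ∀ g', IsProperIdem g' → g' * g = g' → g * g' = g' → g' ≠ g → ratio φ g' = ratio φ g) :
    ratio φ e = ratio φ g := by
  obtain ⟨n, ⟨m, rfl⟩, -, x, hx, ho, hsum, hx'⟩ := hR g e hg.1 hg.2.1 hg.2.2 he.1 he.2.1 he.2.2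
  rw [← hsum]
  refine (ratio_sum_odd φ m x hx ho (fun i => ?_) (by rw [hsum]; exact he.2.2)).2
  obtain ⟨g', u, h1, h2, h3, rfl, h5, h6, h7⟩ := hx' i
  rw [← ratio_conj φ (hx i) u]
  exact h _ ⟨h1, h2, h3⟩ h5 h6 h7

/-- There are at most two ratios. -/
lemma ratio_eq_or_eq_inv (hR : OddlyDecomposable R) {e f : R} (he : IsProperIdem e)
    (hf : IsProperIdem f) : ratio φ f = ratio φ e ∨ ratio φ f = (ratio φ e)⁻¹ := by
  obtain ⟨n, -, hn, x, hx, ho, hsum, hx'⟩ := hR e f he.1 he.2.1 he.2.2 hf.1 hf.2.1 hf.2.2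
  let i : Fin n := ⟨0, by omega⟩
  let j : Fin n := ⟨1, by omega⟩
  have hij : i ≠ j := by simp [i, j]
  have hxf : ∀ k, x k * f = x k ∧ f * x k = x k := fun k => by
    rw [← hsum, Finset.mul_sum, Finset.sum_mul]
    refine ⟨?_, ?_⟩
    · rw [Finset.sum_eq_single k (fun l _ hl => ho k l hl.symm) (by simp)]
      exact (hx k).1
    · rw [Finset.sum_eq_single k (fun l _ hl => ho l k hl) (by simp)]
      exact (hx k).1
  have hne : x i ≠ f := fun h0 => (hx j).2.1 (by rw [← (hxf j).2, ← h0, ho i j hij])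
  have h1 := ratio_of_le φ hf (hx i) (hxf i).1 (hxf i).2 hne
  obtain ⟨g', u, h2, h3, h4, rfl, h5, h6, h7⟩ := hx' i
  have h8 := ratio_of_le φ he ⟨h2, h3, h4⟩ h5 h6 h7
  rw [ratio_conj φ (hx i) u] at h8
  rcases h1 with h1 | h1 <;> rcases h8 with h8 | h8
  · exact Or.inl (h1.symm.trans h8)
  · exact Or.inr (h1.symm.trans h8)
  · right; rw [← h8, h1, monoidHom_inv_inv]
  · left; rw [← monoidHom_inv_inv (ratio φ f), ← h1, h8, monoidHom_inv_inv]

/-- If `θ` preserves orthogonality among idempotents of ratio `y⁻¹` and `ratio (g + h) = y`, then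
no proper subidempotent of `g` has ratio `y⁻¹`. -/
lemma ratio_of_le_of_preserves {y : ℂˣ →* ℂˣ}
    (hX : ∀ a b, IsProperIdem a → IsProperIdem b → ratio φ a = y⁻¹ → ratio φ b = y⁻¹ →
      Orthogonal a b → theta φ a * theta φ b = 0)
    {g h : R} (hg : IsProperIdem g) (hh : IsProperIdem h) (hgh : Orthogonal g h) (h1 : g + h ≠ 1)
    (hrg : ratio φ g = y) (hrh : ratio φ h = y) (hrs : ratio φ (g + h) = y)
    {g' : R} (hg' : IsProperIdem g') (hl : g' * g = g') (hr : g * g' = g') (hne : g' ≠ g) :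
    ratio φ g' = y := by
  have hy := ratio_ne_inv φ hg
  rw [hrg] at hy
  obtain ⟨hd, ho⟩ := hg'.sub_of_le hg hl hr hne
  have hsum : g' + (g - g') = g := add_sub_cancel g' g
  rcases ratio_of_le φ hg hg' hl hr hne with h2 | h2
  · rw [h2, hrg]
  rw [hrg] at h2
  rcases ratio_of_le φ hg hd (by rw [sub_mul, hl, hg.1.eq]) (by rw [mul_sub, hr, hg.1.eq])
    (fun h3 => hg'.2.1 (by simpa using h3)) with h3 | h3
  · have hk := (hg.add hh hgh h1).one_sub
    have hrk := ratio_one_sub φ (hg.add hh hgh h1)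
    have hgk : Orthogonal g (1 - (g + h)) :=
      ⟨by rw [mul_sub, mul_add, hg.1.eq, hgh.1]; simp,
        by rw [sub_mul, add_mul, hg.1.eq, hgh.2]; simp⟩
    have hhk : Orthogonal h (1 - (g + h)) :=
      ⟨by rw [mul_sub, mul_add, hh.1.eq, hgh.2]; simp,
        by rw [sub_mul, add_mul, hh.1.eq, hgh.1]; simp⟩
    have hle : ∀ {x : R}, Orthogonal g x → Orthogonal (g - g') x := fun {x} hx =>
      ⟨by rw [sub_mul, hx.1, ← hl, mul_assoc, hx.1, mul_zero, sub_zero],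
        by rw [mul_sub, hx.2, ← hr, ← mul_assoc, hx.2, zero_mul, sub_zero]⟩
    have hs : g - g' + h + (1 - (g + h)) = 1 - g' := by abel
    have h4 := ratio_add_three φ hd hh hk (hle hgh) (hle hgk) hhk
      (by rw [hs]; exact hg'.one_sub.2.2) (by rw [h3, hrg, hrk, hrs]) (by rw [hrh, hrk, hrs])
    rwa [hs, hrk, hrs, ratio_one_sub φ hg'] at h4
  · rw [hrg] at h3
    have h4 := (ratio_add_eq_iff φ hg' hd ho (by rw [hsum]; exact hg.2.2)
      (h2.trans h3.symm)).2 (hX _ _ hg' hd h2 h3 ho)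
    rw [hsum, hrg, h3] at h4
    exact absurd h4 hy

/-- If `θ` flips orthogonality among idempotents of ratio `y⁻¹` and `ratio (g + h) = y⁻¹`, then
no proper subidempotent of `g` has ratio `y⁻¹`. -/
lemma ratio_of_le_of_flips {y : ℂˣ →* ℂˣ}
    (hX : ∀ a b, IsProperIdem a → IsProperIdem b → ratio φ a = y⁻¹ → ratio φ b = y⁻¹ →
      Orthogonal a b → (1 - theta φ a) * (1 - theta φ b) = 0)
    {g h : R} (hg : IsProperIdem g) (hh : IsProperIdem h) (hgh : Orthogonal g h) (h1 : g + h ≠ 1)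
    (hrg : ratio φ g = y) (hrh : ratio φ h = y) (hrs : ratio φ (g + h) = y⁻¹)
    {g' : R} (hg' : IsProperIdem g') (hl : g' * g = g') (hr : g * g' = g') (hne : g' ≠ g) :
    ratio φ g' = y := by
  have hy := ratio_ne_inv φ hg
  rw [hrg] at hy
  obtain ⟨hd, ho⟩ := hg'.sub_of_le hg hl hr hne
  have hsum : g' + (g - g') = g := add_sub_cancel g' g
  rcases ratio_of_le φ hg hg' hl hr hne with h2 | h2
  · rw [h2, hrg]
  rw [hrg] at h2
  have hk := (hg.add hh hgh h1).one_sub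
  have hrk := ratio_one_sub φ (hg.add hh hgh h1)
  rw [hrs] at hrk
  have hgk : Orthogonal g (1 - (g + h)) :=
    ⟨by rw [mul_sub, mul_add, hg.1.eq, hgh.1]; simp,
      by rw [sub_mul, add_mul, hg.1.eq, hgh.2]; simp⟩
  have hhk : Orthogonal h (1 - (g + h)) :=
    ⟨by rw [mul_sub, mul_add, hh.1.eq, hgh.2]; simp,
      by rw [sub_mul, add_mul, hh.1.eq, hgh.1]; simp⟩
  have hle : ∀ {x : R}, Orthogonal g x → Orthogonal (g - g') x := fun {x} hx =>
    ⟨by rw [sub_mul, hx.1, ← hl, mul_assoc, hx.1, mul_zero, sub_zero],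
      by rw [mul_sub, hx.2, ← hr, ← mul_assoc, hx.2, zero_mul, sub_zero]⟩
  have hle' : ∀ {x : R}, Orthogonal g x → Orthogonal g' x := fun {x} hx =>
    ⟨by rw [← hl, mul_assoc, hx.1, mul_zero], by rw [← hr, ← mul_assoc, hx.2, zero_mul]⟩
  rcases ratio_of_le φ hg hd (by rw [sub_mul, hl, hg.1.eq]) (by rw [mul_sub, hr, hg.1.eq])
    (fun h3 => hg'.2.1 (by simpa using h3)) with h3 | h3
  · rw [hrg] at h3
    have hg'k := hle' hgk
    have hdh := hle hgh
    have hs : g' + (1 - (g + h)) = 1 - (g - g' + h) := by abel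
    have hdh1 := hg'.ne_one_of_orthogonal (ho.symm.add_left (hle' hgh).symm)
    have hg'k1 : g' + (1 - (g + h)) ≠ 1 := by rw [hs]; exact (hd.add hh hdh hdh1).one_sub.2.2
    have hrg'k : ratio φ (g' + (1 - (g + h))) = y := by
      rw [(ratio_add_eq_inv_iff φ hg' hk hg'k hg'k1 (h2.trans hrk.symm)).2
        (hX _ _ hg' hk h2 hrk hg'k), hrk, monoidHom_inv_inv]
    have hdh0 : theta φ (g - g') * theta φ h = 0 := by
      refine (ratio_add_eq_iff φ hd hh hdh hdh1 (h3.trans hrh.symm)).1 ?_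
      rw [← ratio_one_sub φ (hd.add hh hdh hdh1), ← hs, hrg'k, hrh]
    have hg'd : theta φ g' * (1 - theta φ (g - g')) = 0 := by
      have h4 := orthogonal_pair_cases φ hg' hd ho (by rw [hsum]; exact hg.2.2)
      rw [hsum, h2, h3, hrg] at h4
      rcases h4 with h4 | h4 | h4 | h4
      · exact absurd h4.1.symm hy
      · exact absurd h4.1.symm hy
      · exact absurd h4.2.1 hy
      · exact h4.2.2
    have hhk0 : (1 - theta φ h) * theta φ (1 - (g + h)) = 0 := by
      have hs' : h + (1 - (g + h)) = 1 - g := by abel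
      have h4 := orthogonal_pair_cases φ hh hk hhk (by rw [hs']; exact hg.one_sub.2.2)
      rw [hs', ratio_one_sub φ hg, hrg, hrh, hrk] at h4
      rcases h4 with h4 | h4 | h4 | h4
      · exact absurd h4.1 hy
      · exact absurd h4.1 hy
      · exact h4.2.2
      · exact absurd h4.2.1 hy
    have h5 : theta φ g' * theta φ (1 - (g + h)) = 0 := by
      linear_combination (norm := noncomm_ring) hg'd * theta φ (1 - (g + h)) +
        theta φ g' * theta φ (g - g') * hhk0 + theta φ g' * hdh0 * theta φ (1 - (g + h))
    have h6 := (ratio_add_eq_iff φ hg' hk hg'k hg'k1 (h2.trans hrk.symm)).2 h5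
    exact absurd (hrg'k.symm.trans (h6.trans hrk)) hy
  · rw [hrg] at h3
    have hs : g' + (g - g') + (1 - (g + h)) = 1 - h := by abel
    have h4 := ratio_add_three φ hg' hd hk ho (hle' hgk) (hle hgk)
      (by rw [hs]; exact hh.one_sub.2.2) (h2.trans hrk.symm) (h3.trans hrk.symm)
    rw [hs, ratio_one_sub φ hh, hrh, hrk] at h4
    exact absurd h4 hy

lemma mem_Ic_iff {e g : R} (he : IsProperIdem e) :
    g ∈ Ic φ e ↔ IsProperIdem g ∧ ratio φ e = ratio φ g := by
  constructor
  · rintro ⟨h1, h2, h3, h4⟩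
    exact ⟨⟨h1, h2, h3⟩, (cEquiv_iff φ he ⟨h1, h2, h3⟩).1 h4⟩
  · rintro ⟨h1, h2⟩
    exact ⟨h1.1, h1.2.1, h1.2.2, (cEquiv_iff φ he h1).2 h2⟩

lemma flipsOrthOn_of_preservesOrthOn (hR : OddlyDecomposable R) {e f : R} (he : IsProperIdem e)
    (hf : IsProperIdem f) (hne : ratio φ e = (ratio φ f)⁻¹) (hp : PreservesOrthOn φ (Ic φ e)) :
    FlipsOrthOn φ (Ic φ f) := by
  intro g hg h hh h1 h2
  rw [mem_Ic_iff φ hf] at hg hh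
  obtain ⟨hg, hrg⟩ := hg
  obtain ⟨hh, hrh⟩ := hh
  rw [theta_one_sub φ hg.1, theta_one_sub φ hh.1]
  by_cases hs : g + h = 1
  · rw [eq_sub_of_add_eq hs, theta_one_sub φ hh.1, sub_sub_cancel]
    exact (theta_idem φ hh.1).mul_one_sub_self
  rcases orthogonal_same_cases φ hg hh ⟨h1, h2⟩ hs (hrg.symm.trans hrh) with h3 | h3
  · refine absurd ?_ (ratio_ne_inv φ hf)
    rw [← hne, hrg]
    refine (ratio_eq_of_forall_le φ hR hg he fun g' hg' hl hr hg'g => ?_).symm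
    rw [← hrg]
    refine ratio_of_le_of_preserves φ (fun a b ha hb hra hrb hab => ?_) hg hh ⟨h1, h2⟩ hs hrg.symm
      hrh.symm (h3.1.trans hrh.symm) hg' hl hr hg'g
    exact hp a ((mem_Ic_iff φ he).2 ⟨ha, hne.trans hra.symm⟩) b
      ((mem_Ic_iff φ he).2 ⟨hb, hne.trans hrb.symm⟩) hab.1 hab.2
  · exact h3.2

lemma preservesOrthOn_of_flipsOrthOn (hR : OddlyDecomposable R) {e f : R} (he : IsProperIdem e)
    (hf : IsProperIdem f) (hne : ratio φ e = (ratio φ f)⁻¹) (hp : FlipsOrthOn φ (Ic φ e)) :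
    PreservesOrthOn φ (Ic φ f) := by
  intro g hg h hh h1 h2
  rw [mem_Ic_iff φ hf] at hg hh
  obtain ⟨hg, hrg⟩ := hg
  obtain ⟨hh, hrh⟩ := hh
  by_cases hs : g + h = 1
  · rw [eq_sub_of_add_eq hs, theta_one_sub φ hh.1]
    exact (theta_idem φ hh.1).one_sub_mul_self
  rcases orthogonal_same_cases φ hg hh ⟨h1, h2⟩ hs (hrg.symm.trans hrh) with h3 | h3
  · exact h3.2
  · refine absurd ?_ (ratio_ne_inv φ hf)
    rw [← hne, hrg]
    refine (ratio_eq_of_forall_le φ hR hg he fun g' hg' hl hr hg'g => ?_).symm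
    rw [← hrg]
    refine ratio_of_le_of_flips φ (fun a b ha hb hra hrb hab => ?_) hg hh ⟨h1, h2⟩ hs hrg.symm
      hrh.symm (by rw [h3.1, hrh]) hg' hl hr hg'g
    rw [← theta_one_sub φ ha.1, ← theta_one_sub φ hb.1]
    exact hp a ((mem_Ic_iff φ he).2 ⟨ha, hne.trans hra.symm⟩) b
      ((mem_Ic_iff φ he).2 ⟨hb, hne.trans hrb.symm⟩) hab.1 hab.2

end Ratio

theorem statement16 [IsSimpleRing A] [IsSimpleRing B]
    (hA : OddlyDecomposable A) (φ : Aˣ ≃* Bˣ)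
    (e f : A) (he : IsIdempotentElem e) (he0 : e ≠ 0) (he1 : e ≠ 1)
    (hf : IsIdempotentElem f) (hf0 : f ≠ 0) (hf1 : f ≠ 1)
    (hne : ¬ cEquiv (⇑φ) e f) :
    (PreservesOrthOn (⇑φ) (Ic (⇑φ) e) → FlipsOrthOn (⇑φ) (Ic (⇑φ) f)) ∧
    (FlipsOrthOn (⇑φ) (Ic (⇑φ) e) → PreservesOrthOn (⇑φ) (Ic (⇑φ) f)) := by
  have hpe : IsProperIdem e := ⟨he, he0, he1⟩
  have hpf : IsProperIdem f := ⟨hf, hf0, hf1⟩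
  rw [cEquiv_iff φ hpe hpf] at hne
  have hinv : ratio φ e = (ratio φ f)⁻¹ :=
    (ratio_eq_or_eq_inv φ hA hpf hpe).resolve_left hne
  exact ⟨flipsOrthOn_of_preservesOrthOn φ hA hpe hpf hinv,
    preservesOrthOn_of_flipsOrthOn φ hA hpe hpf hinv⟩

end
end

section
/- Let A and B be simple unital complex C*-algebras with A oddly decomposable, and let φ : GL(A) → GL(B) be a group isomorphism. Then there exists a bijection Θ : I(A) → I(B) between the sets of idempotents of A and of B such that: (a) Θ(0) = 0 and Θ(1) = 1; (b) for all commuting idempotents e, f of A, Θ(e) and Θ(f) commute, and ef = 0 if and only if Θ(e)Θ(f) = 0 (Θ is an orthoisomorphism); and (c) for all idempotents e, f of A, e is similar to f in A if and only if Θ(e) is similar to Θ(f) in B. -/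
noncomputable section

variable {A B : Type*}
  [NormedRing A] [StarRing A] [CStarRing A] [CompleteSpace A]
  [NormedAlgebra ℂ A] [StarModule ℂ A]
  [NormedRing B] [StarRing B] [CStarRing B] [CompleteSpace B]
  [NormedAlgebra ℂ B] [StarModule ℂ B]

theorem eq_zero_or_exists_mul_eq_of_commute_corner {R : Type*} [Ring R] [IsSimpleRing R]
    {a p : R} (hp : IsIdempotentElem p) (hpa : p * a = a) (hap : a * p = a)
    (hc : ∀ b, a * (p * b * p) = p * b * p * a) :
    a = 0 ∨ ∃ y, a * (p * y * p) = p := by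
  by_cases ha : a = 0
  · exact Or.inl ha
  right
  have key : ∀ w ∈ AddSubgroup.closure {x * a * y | (x : R) (y : R)}, ∃ y, p * w * p = a * y := by
    intro w hw
    induction hw using AddSubgroup.closure_induction with
    | mem w hw =>
      obtain ⟨x, y, rfl⟩ := hw
      refine ⟨p * x * p * (p * y * p), ?_⟩
      calc p * (x * a * y) * p = p * x * (a) * y * p := by noncomm_ring
        _ = p * x * (p * a * p) * y * p := by rw [hpa, hap]
        _ = (p * x * p * a) * (p * y * p) := by noncomm_ring
        _ = _ := by rw [← hc]; noncomm_ring
    | zero => exact ⟨0, by simp⟩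
    | add u v _ _ hu hv =>
      obtain ⟨y, hy⟩ := hu
      obtain ⟨y', hy'⟩ := hv
      exact ⟨y + y', by rw [mul_add, add_mul, hy, hy', mul_add]⟩
    | neg u _ hu =>
      obtain ⟨y, hy⟩ := hu
      exact ⟨-y, by rw [mul_neg, neg_mul, hy, mul_neg]⟩
  have h1 : (1 : R) ∈ TwoSidedIdeal.span {a} :=
    IsSimpleRing.one_mem_of_ne_zero_mem _ ha (TwoSidedIdeal.subset_span rfl)
  rw [TwoSidedIdeal.mem_span_iff_mem_addSubgroup_closure] at h1
  obtain ⟨y, hy⟩ := key 1 (by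
    refine AddSubgroup.closure_mono ?_ h1
    rintro w hw
    simp only [Set.mem_mul, Set.mem_univ, true_and, Set.mem_singleton_iff] at hw
    grind)
  refine ⟨y, ?_⟩
  rw [mul_one, hp.eq] at hy
  calc a * (p * y * p) = a * p * y * p := by noncomm_ring
    _ = p := by rw [hap, ← hy, hp.eq]

section Corner

variable {R : Type*} [NormedRing R] [NormedAlgebra ℂ R] [CompleteSpace R]

theorem exists_unit_eq_smul_one_sub (b : R) : ∃ (t : ℂ) (u : Rˣ), (u : R) = t • 1 - b := by
  obtain ⟨t, ht⟩ : ∃ t : ℂ, ‖b‖ * ‖(1 : R)‖ < ‖t‖ :=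
    ⟨((‖b‖ * ‖(1 : R)‖ + 1 : ℝ) : ℂ), by
      rw [Complex.norm_real, Real.norm_of_nonneg (by positivity)]; linarith⟩
  have h := spectrum.mem_resolventSet_of_norm_lt_mul ht
  rw [spectrum.mem_resolventSet_iff, Algebra.algebraMap_eq_smul_one] at h
  exact ⟨t, h.unit, rfl⟩

theorem commute_of_commute_units {z : R} (h : ∀ u : Rˣ, z * u = u * z) (b : R) :
    z * b = b * z := by
  obtain ⟨t, u, hu⟩ := exists_unit_eq_smul_one_sub b
  have := h u
  rw [hu, mul_sub, sub_mul] at this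
  simpa using this

variable [IsSimpleRing R]

theorem exists_mul_eq_smul_of_commute_corner {z p : R} (hp : IsIdempotentElem p) (hp0 : p ≠ 0)
    (hzp : z * p = p * z) (hc : ∀ b, z * (p * b * p) = p * b * p * z) :
    ∃ α : ℂ, z * p = α • p := by
  have hpp := hp.eq
  let V : Submodule ℂ R := LinearMap.ker (LinearMap.mulLeft ℂ p - LinearMap.id)
  have hV : ∀ x, x ∈ V ↔ p * x = x := fun x => by simp [V, sub_eq_zero]
  have hVc : IsClosed (V : Set R) := by
    have : (V : Set R) = {x | p * x = x} := by ext x; simp [hV]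
    rw [this]
    exact isClosed_eq (by fun_prop) continuous_id
  have : CompleteSpace V := hVc.completeSpace_coe
  have : Nontrivial V := ⟨⟨⟨p, (hV p).2 hpp⟩, 0, by simpa [Subtype.ext_iff] using hp0⟩⟩
  let L : V →L[ℂ] V := ((ContinuousLinearMap.mul ℂ R z).comp V.subtypeL).codRestrict V (by
    intro x
    have := (hV x).1 x.2
    simp only [ContinuousLinearMap.comp_apply, Submodule.subtypeL_apply,
      ContinuousLinearMap.mul_apply']
    rw [hV, ← mul_assoc, ← hzp, mul_assoc, this])
  have hL : ∀ x, (L x : R) = z * x := fun x => rfl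
  obtain ⟨α, hα⟩ := spectrum.nonempty L
  refine ⟨α, ?_⟩
  have hzp' : p * (z * p) = z * p := by rw [← mul_assoc, ← hzp, mul_assoc, hpp]
  have hcomm : ∀ b, (z * p - α • p) * (p * b * p) = p * b * p * (z * p - α • p) := fun b => by
    have e1 : z * p * (p * b * p) = z * (p * b * p) := by
      rw [mul_assoc z p]; simp only [← mul_assoc, hpp]
    have e2 : p * b * p * (z * p) = p * b * p * z := by
      rw [hzp, ← mul_assoc, mul_assoc _ p p, hpp]
    have e3 : p * (p * b * p) = p * b * p := by simp only [← mul_assoc, hpp]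
    have e4 : p * b * p * p = p * b * p := by rw [mul_assoc _ p p, hpp]
    rw [sub_mul, mul_sub, e1, e2, hc, smul_mul_assoc, mul_smul_comm, e3, e4]
  obtain h | ⟨y, hy⟩ := eq_zero_or_exists_mul_eq_of_commute_corner (a := z * p - α • p) hp
    (by rw [mul_sub, hzp', mul_smul_comm, hpp])
    (by rw [sub_mul, mul_assoc, hpp, smul_mul_assoc, hpp]) hcomm
  · exact sub_eq_zero.1 h
  exfalso
  have hy' := (hcomm y).symm.trans hy
  set w := p * y * p with hw
  have hpw : p * w = w := by simp only [hw, ← mul_assoc, hpp]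
  let M : V →L[ℂ] V := ((ContinuousLinearMap.mul ℂ R (-w)).comp V.subtypeL).codRestrict V (by
    intro x
    simp only [ContinuousLinearMap.comp_apply, Submodule.subtypeL_apply,
      ContinuousLinearMap.mul_apply']
    rw [hV, ← mul_assoc, mul_neg, hpw])
  have hM : ∀ x, (M x : R) = -w * x := fun x => rfl
  have hres : ∀ x, x ∈ V → α • x - z * x = -((z * p - α • p) * x) := fun x hx => by
    rw [sub_mul, mul_assoc, smul_mul_assoc, (hV x).1 hx, neg_sub]
  refine hα ?_
  rw [spectrum.mem_resolventSet_iff, Algebra.algebraMap_eq_smul_one]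
  refine isUnit_iff_exists.2 ⟨M, ?_, ?_⟩
  · ext x
    have h1 : ((((α • (1 : V →L[ℂ] V) - L) * M) x : V) : R) = α • (M x : R) - z * M x := by
      simp [hL]
    rw [h1, hres _ (M x).2, hM, neg_mul, mul_neg, neg_neg, ← mul_assoc, hy, (hV x).1 x.2]
    rfl
  · ext x
    have h1 : (((M * (α • (1 : V →L[ℂ] V) - L)) x : V) : R) = -w * (α • (x : R) - z * x) := by
      simp [hL, hM, mul_sub]
    rw [h1, hres _ x.2, neg_mul_neg, ← mul_assoc, hy', (hV x).1 x.2]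
    rfl

/-- An element of a simple complex Banach algebra that commutes with all units is a scalar. -/
theorem exists_eq_smul_one_of_commute_units {z : R} (h : ∀ u : Rˣ, z * u = u * z) :
    ∃ l : ℂ, z = l • (1 : R) := by
  have h' := commute_of_commute_units h
  simpa using exists_mul_eq_smul_of_commute_corner (z := z) IsIdempotentElem.one one_ne_zero
    (h' 1) (fun b => h' _)

/-- An element of the bicommutant of an idempotent `p` is scalar on `p` and on `1 - p`. -/
theorem exists_smul_of_commute_commutant {z p : R} (hp : IsIdempotentElem p) (hp0 : p ≠ 0)
    (hp1 : p ≠ 1) (h : ∀ u : Rˣ, u * p = p * u → z * u = u * z) :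
    ∃ α β : ℂ, z * p = α • p ∧ z * (1 - p) = β • (1 - p) := by
  have hcc : ∀ b : R, b * p = p * b → z * b = b * z := by
    intro b hb
    obtain ⟨t, y, hy⟩ := exists_unit_eq_smul_one_sub b
    have h1 := h y (by
      rw [hy, sub_mul, mul_sub, hb, smul_mul_assoc, mul_smul_comm, one_mul, mul_one])
    rw [hy, mul_sub, sub_mul, smul_mul_assoc, mul_smul_comm, one_mul, mul_one] at h1
    exact sub_right_injective h1
  have hpp := hp.eq
  have hq := hp.one_sub
  have hq0 : 1 - p ≠ 0 := fun h => hp1 (sub_eq_zero.1 h).symm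
  obtain ⟨α, hα⟩ := exists_mul_eq_smul_of_commute_corner hp hp0 (hcc p rfl) (fun b => hcc _ (by
    rw [mul_assoc _ p p, hpp, ← mul_assoc, ← mul_assoc, hpp]))
  obtain ⟨β, hβ⟩ := exists_mul_eq_smul_of_commute_corner hq hq0
    (hcc _ (by rw [mul_sub, sub_mul, one_mul, mul_one])) (fun b => hcc _ (by
      rw [mul_assoc _ _ p, hp.one_sub_mul_self, ← mul_assoc, ← mul_assoc, hp.mul_one_sub_self]
      simp))
  exact ⟨α, β, hα, hβ⟩

end Corner

section Idempotent

variable {R : Type*} [Ring R] [Algebra ℂ R]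

theorem IsIdempotentElem.eq_zero_or_one_of_eq_smul_one {p : R} (hp : IsIdempotentElem p) {t : ℂ}
    (h : p = t • (1 : R)) : p = 0 ∨ p = 1 := by
  have h1 : (t - 1) • p = 0 := by
    have := hp.eq
    nth_rewrite 1 [h] at this
    rw [smul_mul_assoc, one_mul] at this
    rw [sub_smul, this, one_smul, sub_self]
  rcases smul_eq_zero.1 h1 with h2 | h2
  · right; rw [h, sub_eq_zero.1 h2, one_smul]
  · exact Or.inl h2

theorem IsIdempotentElem.eq_zero_or_one_of_one_add_smul {p : R} (hp : IsIdempotentElem p) {s t : ℂ}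
    (hs : s ≠ 0) (h : 1 + s • p = t • (1 : R)) : p = 0 ∨ p = 1 := by
  refine hp.eq_zero_or_one_of_eq_smul_one (t := s⁻¹ * (t - 1)) ?_
  rw [mul_smul, sub_smul, ← h, one_smul, add_sub_cancel_left, inv_smul_smul₀ hs]

theorem IsIdempotentElem.one_add_smul_mul_self {p : R} (hp : IsIdempotentElem p) (c : ℂ) :
    (1 + (c - 1) • p) * (1 + (c - 1) • p) = (c + 1) • (1 + (c - 1) • p) - c • (1 : R) := by
  simp only [mul_add, add_mul, mul_one, one_mul, smul_mul_assoc, mul_smul_comm, hp.eq]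
  module

theorem IsIdempotentElem.eq_of_one_add_smul_eq_smul {p q : R} (hp : IsIdempotentElem p)
    (hq : IsIdempotentElem q) (hp0 : p ≠ 0) (hp1 : p ≠ 1) {c m : ℂ} (hc : c ^ 2 ≠ 1)
    (h : 1 + (c - 1) • p = m • (1 + (c - 1) • q)) : p = q := by
  have hc1 : c - 1 ≠ 0 := fun h => hc (by rw [sub_eq_zero.1 h, one_pow])
  have hc2 : c + 1 ≠ 0 := fun h => hc (by rw [eq_neg_of_add_eq_zero_left h]; norm_num)
  by_cases hm : m = 1
  · rw [hm, one_smul] at h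
    exact smul_right_injective R hc1 (add_left_cancel h)
  exfalso
  have h1 := hp.one_add_smul_mul_self c
  have h2 := hq.one_add_smul_mul_self c
  set x := 1 + (c - 1) • p with hx
  set y := 1 + (c - 1) • q with hy
  rw [h, smul_mul_assoc, mul_smul_comm, h2] at h1
  have h3 : (m - 1) • ((c + 1) • x - (c * (m + 1)) • (1 : R)) = 0 := by
    rw [h, ← sub_eq_zero.2 h1]
    module
  rcases smul_eq_zero.1 h3 with h4 | h4
  · exact hm (sub_eq_zero.1 h4)
  · have h5 : x = ((c + 1)⁻¹ * (c * (m + 1))) • (1 : R) := by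
      rw [mul_smul, ← sub_eq_zero.1 h4, inv_smul_smul₀ hc2]
    rcases hp.eq_zero_or_one_of_one_add_smul hc1 h5 with h6 | h6
    · exact hp0 h6
    · exact hp1 h6

end Idempotent

section Idempotent

variable {R : Type*} [Ring R] [Algebra ℂ R]

theorem eq_or_eq_of_mul_eq_smul {x r : R} (hr : IsIdempotentElem r) {m k : ℂ}
    (hx : x = m • (1 + (k - 1) • r)) {v : ℂ} {e : R} (he : e ≠ 0) (hxe : x * e = v • e) :
    v = m ∨ v = m * k := by
  have hx2 : x * x = (m * (k + 1)) • x - (m ^ 2 * k) • (1 : R) := by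
    rw [hx, smul_mul_assoc, mul_smul_comm, hr.one_add_smul_mul_self]
    module
  have h1 : x * x * e = (v ^ 2) • e := by
    rw [mul_assoc, hxe, mul_smul_comm, hxe, smul_smul, sq]
  rw [hx2, sub_mul, smul_mul_assoc, hxe, smul_mul_assoc, one_mul] at h1
  have h2 : ((v - m) * (v - m * k)) • e = 0 := by
    rw [← sub_eq_zero.2 h1.symm]
    module
  rcases mul_eq_zero.1 ((smul_eq_zero.1 h2).resolve_right he) with h | h
  · exact Or.inl (sub_eq_zero.1 h)
  · exact Or.inr (sub_eq_zero.1 h)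

/-- The eigenvalues of a product of two commuting elements of the form `1 + (c - 1) • p` that is
itself, up to a scalar, of this form. -/
theorem eigenvalues_of_mul_eq_smul {p q r : R} (hp : IsIdempotentElem p) (hq : IsIdempotentElem q)
    (hr : IsIdempotentElem r) (hpq : p * q = q * p) {c d m k : ℂ}
    (h : (1 + (c - 1) • p) * (1 + (d - 1) • q) = m • (1 + (k - 1) • r)) :
    (p * q = 0 ∨ c * d = m ∨ c * d = m * k) ∧ (p * (1 - q) = 0 ∨ c = m ∨ c = m * k) ∧
      ((1 - p) * q = 0 ∨ d = m ∨ d = m * k) ∧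
      ((1 - p) * (1 - q) = 0 ∨ 1 = m ∨ 1 = m * k) := by
  have hpp := hp.eq
  have hqq := hq.eq
  have a1 : (1 + (c - 1) • p) * p = c • p := by
    rw [add_mul, smul_mul_assoc, hpp, one_mul]; module
  have a2 : (1 + (c - 1) • p) * (1 - p) = (1 : ℂ) • (1 - p) := by
    rw [add_mul, smul_mul_assoc, mul_sub p, hpp]; simp
  have b1 : (1 + (d - 1) • q) * q = d • q := by
    rw [add_mul, smul_mul_assoc, hqq, one_mul]; module
  have b2 : (1 + (d - 1) • q) * (1 - q) = (1 : ℂ) • (1 - q) := by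
    rw [add_mul, smul_mul_assoc, mul_sub q, hqq]; simp
  have c1 : Commute (1 + (d - 1) • q) p :=
    (Commute.one_left p).add_left ((show Commute q p from hpq.symm).smul_left _)
  have c2 : Commute (1 + (d - 1) • q) (1 - p) := (Commute.one_right _).sub_right c1
  have key : ∀ e f : R, ∀ s t : ℂ, (1 + (c - 1) • p) * e = s • e → (1 + (d - 1) • q) * f = t • f →
      Commute (1 + (d - 1) • q) e → e * f = 0 ∨ s * t = m ∨ s * t = m * k := by
    intro e f s t he hf hc
    by_cases h0 : e * f = 0
    · exact Or.inl h0
    right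
    refine eq_or_eq_of_mul_eq_smul hr h h0 ?_
    calc (1 + (c - 1) • p) * (1 + (d - 1) • q) * (e * f)
        = (1 + (c - 1) • p) * ((1 + (d - 1) • q) * e) * f := by noncomm_ring
      _ = ((1 + (c - 1) • p) * e) * ((1 + (d - 1) • q) * f) := by rw [hc.eq]; noncomm_ring
      _ = _ := by rw [he, hf, smul_mul_smul_comm]
  exact ⟨key _ _ _ _ a1 b1 c1, by simpa using key _ _ _ _ a1 b2 c1,
    by simpa using key _ _ _ _ a2 b1 c2, by simpa using key _ _ _ _ a2 b2 c2⟩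

end Idempotent

section SpectralImage

variable {A B : Type*} [Ring A] [Ring B] [Algebra ℂ B]

/-- The image under `φ` of the unit `1 + e` is, up to a nonzero scalar, `1 + (c - 1) • p`
with `p` idempotent. -/
def SpectralImage (φ : Aˣ ≃* Bˣ) (c : ℂ) (e : A) (p : B) : Prop :=
  IsIdempotentElem p ∧ ∃ (u : Aˣ) (b : ℂ), (u : A) = 1 + e ∧ b ≠ 0 ∧
    (φ u : B) = b • (1 + (c - 1) • p)

variable {φ : Aˣ ≃* Bˣ} {c d k : ℂ} {e f : A} {p q r : B}

theorem IsIdempotentElem.exists_unit_eq_one_add [Algebra ℂ A] (he : IsIdempotentElem e) :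
    ∃ u : Aˣ, (u : A) = 1 + e ∧ ((u⁻¹ : Aˣ) : A) = 1 - (2⁻¹ : ℂ) • e := by
  refine ⟨⟨1 + e, 1 - (2⁻¹ : ℂ) • e, ?_, ?_⟩, rfl, rfl⟩ <;>
  · simp only [mul_sub, sub_mul, mul_add, add_mul, mul_one, one_mul, smul_mul_assoc,
      mul_smul_comm, he.eq]
    module

namespace SpectralImage

theorem exists_map_eq (h : SpectralImage φ c e p) {u : Aˣ} (hu : (u : A) = 1 + e) :
    ∃ b : ℂ, b ≠ 0 ∧ (φ u : B) = b • (1 + (c - 1) • p) := by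
  obtain ⟨-, v, b, hv, hb, h⟩ := h
  obtain rfl : u = v := Units.ext (hu.trans hv.symm)
  exact ⟨b, hb, h⟩

theorem flip (hc : c ≠ 0) (h : SpectralImage φ c e p) : SpectralImage φ c⁻¹ e (1 - p) := by
  obtain ⟨hp, u, b, hu, hb, h⟩ := h
  refine ⟨hp.one_sub, u, b * c, hu, mul_ne_zero hb hc, ?_⟩
  rw [h]
  match_scalars <;> (field_simp; ring)

theorem conj (h : SpectralImage φ c e p) (w : Aˣ) :
    SpectralImage φ c (w * e * ((w⁻¹ : Aˣ) : A)) ((φ w : B) * p * (((φ w)⁻¹ : Bˣ) : B)) := by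
  obtain ⟨hp, u, b, hu, hb, h⟩ := h
  refine ⟨?_, w * u * w⁻¹, b, ?_, hb, ?_⟩
  · simp only [IsIdempotentElem, ← mul_assoc, Units.inv_mul_cancel_right]
    rw [mul_assoc _ p p, hp.eq]
  · simp [hu, mul_add, add_mul]
  · simp [h, mul_add, add_mul]

theorem commute (h : SpectralImage φ c e p) (h' : SpectralImage φ d f q) (hc : c ≠ 1)
    (hd : d ≠ 1) (hef : e * f = f * e) : p * q = q * p := by
  obtain ⟨hp, u, b, hu, hb, h⟩ := h
  obtain ⟨hq, v, b', hv, hb', h'⟩ := h'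
  have h1 : u * v = v * u := Units.ext (by
    simp only [Units.val_mul, hu, hv, mul_add, add_mul, mul_one, one_mul, hef]; abel)
  have h2 : (φ u : B) * φ v = φ v * φ u := by
    rw [← Units.val_mul, ← map_mul, h1, map_mul, Units.val_mul]
  rw [h, h'] at h2
  have h3 : (b * b' * ((c - 1) * (d - 1))) • (p * q - q * p) = 0 := by
    rw [← sub_eq_zero] at h2
    rw [← h2]
    simp only [mul_add, add_mul, mul_one, one_mul, smul_mul_assoc, mul_smul_comm]
    module
  refine sub_eq_zero.1 ((smul_eq_zero.1 h3).resolve_left ?_)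
  simp [hb, hb', sub_eq_zero, hc, hd]

end SpectralImage
end SpectralImage

section BanachAlgebra

variable {A B : Type*} [NormedRing A] [NormedAlgebra ℂ A] [CompleteSpace A] [IsSimpleRing A]

namespace SpectralImage

variable [Ring B] [Algebra ℂ B] {φ : Aˣ ≃* Bˣ} {c : ℂ} {e f : A} {p q : B}

theorem exists_eq_smul_one_of_map {u : Aˣ} {l : ℂ} (h : (φ u : B) = l • (1 : B)) :
    ∃ t : ℂ, (u : A) = t • (1 : A) := by
  refine exists_eq_smul_one_of_commute_units fun v => ?_
  have : u * v = v * u := φ.injective (Units.ext (by simp [h]))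
  rw [← Units.val_mul, this, Units.val_mul]

theorem exists_eq_smul_of_map_eq_smul {u v : Aˣ} {l : ℂ} (h : (φ u : B) = l • (φ v : B)) :
    ∃ t : ℂ, (u : A) = t • (v : A) := by
  obtain ⟨t, ht⟩ := exists_eq_smul_one_of_map (φ := φ) (u := u * v⁻¹) (l := l) (by
    rw [map_mul, map_inv, Units.val_mul, h, smul_mul_assoc, Units.mul_inv])
  refine ⟨t, ?_⟩
  rw [Units.val_mul] at ht
  calc (u : A) = u * ((v⁻¹ : Aˣ) : A) * v := by simp
    _ = _ := by rw [ht, smul_mul_assoc, one_mul]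

theorem nontrivial (h : SpectralImage φ c e p) (he : IsIdempotentElem e) (he0 : e ≠ 0)
    (he1 : e ≠ 1) : p ≠ 0 ∧ p ≠ 1 ∧ c ^ 2 ≠ 1 := by
  obtain ⟨hp, u, b, hu, hb, h⟩ := h
  have key : ∀ {s t : ℂ}, s ≠ 0 → 1 + s • e ≠ t • (1 : A) := fun hs ht =>
    (he.eq_zero_or_one_of_one_add_smul hs ht).elim he0 he1
  refine ⟨?_, ?_, ?_⟩
  · rintro rfl
    obtain ⟨t, ht⟩ := exists_eq_smul_one_of_map (φ := φ) (u := u) (l := b) (by simpa using h)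
    exact key (s := 1) one_ne_zero (by rw [one_smul, ← hu, ht])
  · rintro rfl
    obtain ⟨t, ht⟩ := exists_eq_smul_one_of_map (φ := φ) (u := u) (l := b * c) (by
      rw [h]; module)
    exact key (s := 1) one_ne_zero (by rw [one_smul, ← hu, ht])
  · intro hc
    obtain ⟨t, ht⟩ := exists_eq_smul_one_of_map (φ := φ) (u := u * u) (l := b ^ 2) (by
      rw [map_mul, Units.val_mul, h, smul_mul_assoc, mul_smul_comm, hp.one_add_smul_mul_self]
      have : b • b • ((c + 1) • (1 + (c - 1) • p) - c • (1 : B)) =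
        (b ^ 2) • (1 + (c ^ 2 - 1) • p) := by module
      rw [this, hc]
      simp)
    refine key (s := 3) (t := t) (by norm_num) ?_
    rw [← ht, Units.val_mul, hu, mul_add, add_mul, add_mul, he.eq]
    simp only [mul_one, one_mul]
    module

theorem unique (h : SpectralImage φ c e p) (h' : SpectralImage φ c e q) (he : IsIdempotentElem e)
    (he0 : e ≠ 0) (he1 : e ≠ 1) : p = q := by
  obtain ⟨hp0, hp1, hc⟩ := h.nontrivial he he0 he1
  obtain ⟨u, hu, -⟩ := he.exists_unit_eq_one_add
  obtain ⟨b, hb, h1⟩ := h.exists_map_eq hu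
  obtain ⟨b', hb', h2⟩ := h'.exists_map_eq hu
  refine h.1.eq_of_one_add_smul_eq_smul h'.1 hp0 hp1 hc (m := b⁻¹ * b') ?_
  rw [mul_smul, ← h2, h1, inv_smul_smul₀ hb]

theorem injective (h : SpectralImage φ c e p) (h' : SpectralImage φ c f p)
    (he : IsIdempotentElem e) (hf : IsIdempotentElem f)
    (he0 : e ≠ 0) (he1 : e ≠ 1) : e = f := by
  obtain ⟨-, u, b, hu, hb, h⟩ := h
  obtain ⟨-, v, b', hv, hb', h'⟩ := h'
  obtain ⟨t, ht⟩ := exists_eq_smul_of_map_eq_smul (φ := φ) (u := u) (v := v) (l := b * b'⁻¹) (by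
    rw [h, h', mul_smul, inv_smul_smul₀ hb'])
  refine he.eq_of_one_add_smul_eq_smul hf he0 he1 (c := 2) (m := t) (by norm_num) ?_
  have : (2 : ℂ) - 1 = 1 := by norm_num
  rw [this, one_smul, one_smul, ← hu, ← hv, ht]

end SpectralImage

end BanachAlgebra

section BanachAlgebra

variable {A B : Type*} [Ring A] [Algebra ℂ A] [NormedRing B] [NormedAlgebra ℂ B] [CompleteSpace B]
  [IsSimpleRing B]
  {φ : Aˣ ≃* Bˣ} {c : ℂ} {e : A} {p : B}

theorem SpectralImage.compl (hc : c ≠ 0) (he : IsIdempotentElem e) (h : SpectralImage φ c e p) :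
    SpectralImage φ c (1 - e) (1 - p) := by
  obtain ⟨u, hu, hu'⟩ := he.exists_unit_eq_one_add
  obtain ⟨b, hb, h1⟩ := h.exists_map_eq hu
  have hp := h.1
  let w : Aˣ := Units.map (algebraMap ℂ A : ℂ →* A) (Units.mk0 2 two_ne_zero)
  have hw : (w : A) = (2 : ℂ) • (1 : A) := Algebra.algebraMap_eq_smul_one _
  obtain ⟨l, hl⟩ := SpectralImage.exists_eq_smul_one_of_map (φ := φ.symm) (u := φ w) (l := 2)
    (by rw [φ.symm_apply_apply, hw])
  have hl0 : l ≠ 0 := by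
    rintro rfl
    exact (φ w).ne_zero (by rw [hl, zero_smul])
  have hinv : (((φ u)⁻¹ : Bˣ) : B) = b⁻¹ • (1 + (c⁻¹ - 1) • p) := by
    refine Units.inv_eq_of_mul_eq_one_right ?_
    rw [h1]
    simp only [smul_mul_assoc, mul_smul_comm, smul_smul, mul_add, add_mul, mul_one, one_mul, hp.eq]
    match_scalars <;> field_simp
    ring
  refine ⟨hp.one_sub, w * u⁻¹, l * b⁻¹ * c⁻¹, ?_, ?_, ?_⟩
  · rw [Units.val_mul, hw, hu', smul_mul_assoc, one_mul]
    module
  · simp [hl0, hb, hc]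
  · rw [map_mul, map_inv, Units.val_mul, hl, hinv, smul_mul_assoc, one_mul]
    match_scalars <;> field_simp <;> ring

theorem exists_spectralImage_of_map (he : IsIdempotentElem e) (hp : IsIdempotentElem p)
    (hp0 : p ≠ 0) (hp1 : p ≠ 1) {v : Aˣ} (hv : (v : A) = 1 - (2 : ℂ) • e)
    (h : (φ v : B) = 1 - (2 : ℂ) • p) : ∃ c : ℂ, c ≠ 0 ∧ SpectralImage φ c e p := by
  obtain ⟨u, hu, -⟩ := he.exists_unit_eq_one_add
  have hcu : ∀ y : Bˣ, (y : B) * p = p * y → (φ u : B) * y = y * φ u := by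
    intro y hy
    have h1 : y * φ v = φ v * y := Units.ext (by
      simp only [Units.val_mul, h, mul_sub, sub_mul, mul_one, one_mul, mul_smul_comm,
        smul_mul_assoc, hy])
    have h2 : φ.symm y * v = v * φ.symm y := φ.injective (by simpa using h1)
    have h3 : ((φ.symm y : Aˣ) : A) * e = e * (φ.symm y : Aˣ) := by
      have h4 := congrArg Units.val h2
      simp only [Units.val_mul, hv, mul_sub, sub_mul, mul_one, one_mul, mul_smul_comm,
        smul_mul_assoc] at h4
      exact smul_right_injective A (two_ne_zero (α := ℂ)) (sub_right_injective h4)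
    have h5 : u * φ.symm y = φ.symm y * u := Units.ext (by
      simp only [Units.val_mul, hu, mul_add, add_mul, mul_one, one_mul, h3])
    have h6 := congrArg (fun x => ((φ x : Bˣ) : B)) h5
    simpa using h6
  obtain ⟨α, β, hα, hβ⟩ := exists_smul_of_commute_commutant hp hp0 hp1 hcu
  have hq0 : 1 - p ≠ 0 := fun h => hp1 (sub_eq_zero.1 h).symm
  have key : ∀ (t : ℂ) (x : B), x ≠ 0 → (φ u : B) * x = t • x → t ≠ 0 := by
    rintro t x hx h rfl
    rw [zero_smul, Units.mul_right_eq_zero] at h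
    exact hx h
  have hα0 := key α p hp0 hα
  have hβ0 := key β _ hq0 hβ
  refine ⟨α * β⁻¹, by simp [hα0, hβ0], hp, u, β, hu, hβ0, ?_⟩
  have : (φ u : B) = φ u * p + φ u * (1 - p) := by rw [← mul_add]; simp
  rw [this, hα, hβ]
  match_scalars <;> field_simp
  ring

end BanachAlgebra

section Orthogonal

variable {A B : Type*} [Ring A] [Ring B]

/-- Three pairwise orthogonal nonzero idempotents. -/
structure OrthTriple (a b c : A) : Prop where
  idem₁ : IsIdempotentElem a
  idem₂ : IsIdempotentElem b
  idem₃ : IsIdempotentElem c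
  ne₁ : a ≠ 0
  ne₂ : b ≠ 0
  ne₃ : c ≠ 0
  mul₁₂ : a * b = 0
  mul₂₁ : b * a = 0
  mul₁₃ : a * c = 0
  mul₃₁ : c * a = 0
  mul₂₃ : b * c = 0
  mul₃₂ : c * b = 0

/-- `x` is a nonzero idempotent strictly below the idempotent `e`. -/
structure ProperSub (x e : A) : Prop where
  idem₁ : IsIdempotentElem x
  idem₂ : IsIdempotentElem e
  mul₁₂ : x * e = x
  mul₂₁ : e * x = x
  ne_zero : x ≠ 0
  ne : x ≠ e

namespace OrthTriple

variable {a b c x : A}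

theorem swap₁₂ (h : OrthTriple a b c) : OrthTriple b a c :=
  ⟨h.2, h.1, h.3, h.5, h.4, h.6, h.8, h.7, h.11, h.12, h.9, h.10⟩

theorem swap₂₃ (h : OrthTriple a b c) : OrthTriple a c b :=
  ⟨h.1, h.3, h.2, h.4, h.6, h.5, h.9, h.10, h.7, h.8, h.12, h.11⟩

theorem of_properSub (h : OrthTriple a b c) (hx : ProperSub x a) : OrthTriple x b c := by
  refine ⟨hx.1, h.2, h.3, hx.ne_zero, h.5, h.6, ?_, ?_, ?_, ?_, h.11, h.12⟩
  · rw [← hx.mul₁₂, mul_assoc, h.mul₁₂, mul_zero]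
  · rw [← hx.mul₂₁, ← mul_assoc, h.mul₂₁, zero_mul]
  · rw [← hx.mul₁₂, mul_assoc, h.mul₁₃, mul_zero]
  · rw [← hx.mul₂₁, ← mul_assoc, h.mul₃₁, zero_mul]

theorem ne_one₁ (h : OrthTriple a b c) : a ≠ 1 := by
  rintro rfl
  exact h.ne₂ (by simpa using h.mul₁₂)

theorem add_idem (h : OrthTriple a b c) : IsIdempotentElem (a + b) := by
  simp [IsIdempotentElem, mul_add, add_mul, h.mul₁₂, h.mul₂₁, h.idem₁.eq, h.idem₂.eq]

theorem add_ne_zero (h : OrthTriple a b c) : a + b ≠ 0 := fun h0 => by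
  have := congrArg (a * ·) h0
  simp only [mul_add, h.mul₁₂, h.idem₁.eq, add_zero, mul_zero] at this
  exact h.ne₁ this

theorem add_ne_one (h : OrthTriple a b c) : a + b ≠ 1 := fun h0 => by
  have := congrArg (· * c) h0
  simp only [add_mul, h.mul₁₃, h.mul₂₃, add_zero, one_mul] at this
  exact h.ne₃ this.symm

theorem properSub_add (h : OrthTriple a b c) : ProperSub a (a + b) := by
  refine ⟨h.1, h.add_idem, ?_, ?_, h.4, ?_⟩
  · rw [mul_add, h.1.eq, h.mul₁₂, add_zero]
  · rw [add_mul, h.1.eq, h.mul₂₁, add_zero]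
  · simpa using h.ne₂

end OrthTriple

namespace ProperSub

variable {e x y : A}

theorem iff_one : ProperSub e 1 ↔ IsIdempotentElem e ∧ e ≠ 0 ∧ e ≠ 1 :=
  ⟨fun h => ⟨h.1, h.5, h.6⟩, fun h => ⟨h.1, .one, by simp, by simp, h.2.1, h.2.2⟩⟩

theorem sub (h : ProperSub x e) : ProperSub (e - x) e := by
  refine ⟨?_, h.2, ?_, ?_, sub_ne_zero.2 h.ne.symm, ?_⟩
  · simp [IsIdempotentElem, mul_sub, sub_mul, h.idem₁.eq, h.idem₂.eq, h.mul₁₂, h.mul₂₁]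
  · simp [sub_mul, h.idem₂.eq, h.mul₁₂]
  · simp [mul_sub, h.idem₂.eq, h.mul₂₁]
  · simpa using h.ne_zero

theorem trans_one (h : ProperSub x e) : ProperSub x 1 := by
  refine iff_one.2 ⟨h.1, h.5, ?_⟩
  rintro rfl
  exact h.ne (by simpa using h.mul₁₂.symm)

theorem orthTriple (h : ProperSub x e) (hy : IsIdempotentElem y) (hy0 : y ≠ 0) (h1 : e * y = 0)
    (h2 : y * e = 0) : OrthTriple x (e - x) y := by
  have h3 : x * y = 0 := by rw [← h.mul₁₂, mul_assoc, h1, mul_zero]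
  have h4 : y * x = 0 := by rw [← h.mul₂₁, ← mul_assoc, h2, zero_mul]
  refine ⟨h.1, h.sub.1, hy, h.5, h.sub.5, hy0, ?_, ?_, h3, h4, ?_, ?_⟩
  · simp [mul_sub, h.mul₁₂, h.idem₁.eq]
  · simp [sub_mul, h.mul₂₁, h.idem₁.eq]
  · rw [sub_mul, h1, h3, sub_zero]
  · rw [mul_sub, h2, h4, sub_zero]

theorem orthTriple_one_sub (h : ProperSub x e) (he : ProperSub e 1) :
    OrthTriple x (e - x) (1 - e) :=
  h.orthTriple he.sub.1 he.sub.5 he.idem₁.mul_one_sub_self he.idem₁.one_sub_mul_self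

theorem conj (h : ProperSub x e) (u : Aˣ) :
    ProperSub (u * x * ((u⁻¹ : Aˣ) : A)) (u * e * ((u⁻¹ : Aˣ) : A)) := by
  have key : ∀ a b : A, (u * a * ((u⁻¹ : Aˣ) : A)) * (u * b * ((u⁻¹ : Aˣ) : A)) =
      u * (a * b) * ((u⁻¹ : Aˣ) : A) := fun a b => by simp [mul_assoc]
  refine ⟨?_, ?_, ?_, ?_, ?_, ?_⟩
  · rw [IsIdempotentElem, key, h.idem₁.eq]
  · rw [IsIdempotentElem, key, h.idem₂.eq]
  · rw [key, h.mul₁₂]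
  · rw [key, h.mul₂₁]
  · simpa using h.ne_zero
  · simpa using h.ne

end ProperSub

theorem OrthTriple.properSub_one₁ {e f g : A} (h : OrthTriple e f g) : ProperSub e 1 :=
  ProperSub.iff_one.2 ⟨h.1, h.4, h.ne_one₁⟩

theorem OrthTriple.properSub_one_add {e f g : A} (h : OrthTriple e f g) : ProperSub (e + f) 1 :=
  ProperSub.iff_one.2 ⟨h.add_idem, h.add_ne_zero, h.add_ne_one⟩

/-- If `ψ` sends orthogonal idempotents to idempotents that are either orthogonal or
have orthogonal complements, and any two proper idempotents of `A` are related by a common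
subidempotent up to similarity, then one of the two alternatives holds uniformly. -/
theorem forall_mul_eq_zero_or_forall_mul_ne_zero {ψ : A → B}
    (hcomm : ∀ a b c, OrthTriple a b c → ψ a * ψ b = ψ b * ψ a)
    (hne : ∀ e, ProperSub e 1 → ψ e ≠ 0 ∧ ψ e ≠ 1)
    (hdich : ∀ a b c, OrthTriple a b c → ψ a * ψ b = 0 ∨ (1 - ψ a) * (1 - ψ b) = 0)
    (hconj : ∀ (u : Aˣ) (a b : A), ProperSub a 1 → ProperSub b 1 → ψ a * ψ b = 0 →
      ψ (u * a * ((u⁻¹ : Aˣ) : A)) * ψ (u * b * ((u⁻¹ : Aˣ) : A)) = 0)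
    (hconn : ∀ e f : A, ProperSub e 1 → ProperSub f 1 → ∃ (g g' : A) (u : Aˣ),
      ProperSub g f ∧ ProperSub g' e ∧ g' = u * g * ((u⁻¹ : Aˣ) : A)) :
    (∀ a b c, OrthTriple a b c → ψ a * ψ b = 0) ∨ (∀ a b c, OrthTriple a b c → ψ a * ψ b ≠ 0) := by
  have one_sub : ∀ {e : A}, ProperSub e 1 → ProperSub (1 - e) 1 := fun h => h.sub
  have ne_one : ∀ {a b c : A}, OrthTriple a b c → ProperSub a 1 := fun h =>
    ProperSub.iff_one.2 ⟨h.1, h.4, h.ne_one₁⟩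
  have symm : ∀ {a b c}, OrthTriple a b c → ψ a * ψ b = 0 → ψ b * ψ a = 0 := fun h h0 => by
    rw [← hcomm _ _ _ h, h0]
  have step : ∀ {a b c}, OrthTriple a b c → ψ a * ψ b = 0 → ψ a * ψ c = 0 := by
    intro a b c h hab
    by_contra hac
    have hac' := (hdich _ _ _ h.swap₂₃).resolve_left hac
    have hba := symm h hab
    rcases hdich _ _ _ h.swap₁₂.swap₂₃ with hbc | hbc
    · refine (hne b (ne_one h.swap₁₂)).1 ?_
      have e1 : ψ b * ((1 - ψ a) * (1 - ψ c)) = ψ b := by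
        rw [← mul_assoc, mul_sub (ψ b), hba, mul_one, sub_zero, mul_sub, hbc, mul_one, sub_zero]
      rw [← e1, hac', mul_zero]
    · refine (hne c (ne_one h.swap₂₃.swap₁₂)).2 ?_
      have e1 : 1 - ψ c = ψ a * (1 - ψ c) := by
        rw [sub_mul, one_mul, sub_eq_zero] at hac'; exact hac'
      have e2 : 1 - ψ c = ψ b * (1 - ψ c) := by
        rw [sub_mul, one_mul, sub_eq_zero] at hbc; exact hbc
      have e3 : 1 - ψ c = 0 := by rw [e1, e2, ← mul_assoc, hab, zero_mul]
      exact (sub_eq_zero.1 e3).symm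
  have split : ∀ e : A, ProperSub e 1 → ∃ x, ProperSub x e := fun e he => by
    obtain ⟨g, -, -, hg, -⟩ := hconn e e he he
    exact ⟨g, hg⟩
  have cross : ∀ {x y e}, ProperSub e 1 → ProperSub x e → ProperSub y (1 - e) →
      ψ x * ψ (1 - e) = 0 → ψ y * ψ e = 0 := by
    intro x y e he hx hy h
    have t1 := hx.orthTriple_one_sub he
    have t2 := (t1.swap₂₃.swap₁₂.of_properSub hy).swap₁₂.swap₂₃
    have t3 := hy.orthTriple hx.1 hx.5
      (by simpa using t1.mul₃₁) (by simpa using t1.mul₁₃)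
    have t4 := hy.orthTriple he.1 he.5 he.idem₁.one_sub_mul_self he.idem₁.mul_one_sub_self
    have g1 := step t2 (step t1.swap₂₃ h)
    exact step t4 (step t3.swap₂₃ (symm t2.swap₂₃ g1))
  let T : A → Prop := fun e => ∃ x, ProperSub x e ∧ ψ x * ψ (1 - e) = 0
  have T_all : ∀ {e x}, ProperSub e 1 → T e → ProperSub x e → ψ x * ψ (1 - e) = 0 := by
    rintro e x he ⟨x', hx', h⟩ hx
    obtain ⟨y, hy⟩ := split _ (one_sub he)
    have := cross (x := y) (y := x) (e := 1 - e) (one_sub he) hy (by simpa using hx)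
      (by simpa using cross he hx' hy h)
    exact this
  have T_mono : ∀ {e y}, ProperSub e 1 → ProperSub y e → (T y ↔ T e) := by
    intro e y he hy
    have hy1 := hy.trans_one
    obtain ⟨z, hz⟩ := split y hy1
    have t0 := hy.orthTriple_one_sub he
    have t1 := hz.orthTriple_one_sub hy1
    have t2 := hz.orthTriple t0.idem₂ t0.ne₂ t0.mul₁₂ t0.mul₂₁
    have t3 := t0.of_properSub hz
    constructor
    · intro h
      have g1 := step t2 (step t1.swap₂₃ (T_all hy1 h hz))
      have g2 := step t3.swap₁₂ (symm t3 g1)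
      have g3 := step t0.swap₂₃.swap₁₂.swap₂₃ (symm t0.swap₁₂.swap₂₃ g2)
      exact ⟨y, hy, symm t0.swap₂₃.swap₁₂ g3⟩
    · intro h
      have g1 := symm t0.swap₂₃ (T_all he h hy)
      have g2 := symm t0.swap₂₃.swap₁₂.swap₂₃ (step t0.swap₂₃.swap₁₂ g1)
      have g3 := symm t3.swap₁₂ (step t3.swap₁₂.swap₂₃ g2)
      exact ⟨z, hz, step t1 (step t2.swap₂₃ g3)⟩
  have T_conj : ∀ {e} (u : Aˣ), ProperSub e 1 → T e → T (u * e * ((u⁻¹ : Aˣ) : A)) := by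
    rintro e u he ⟨x, hx, h⟩
    refine ⟨_, hx.conj u, ?_⟩
    have := hconj u _ _ hx.trans_one (one_sub he) h
    simpa [mul_sub, sub_mul] using this
  have T_imp : ∀ {e f}, ProperSub e 1 → ProperSub f 1 → T e → T f := by
    intro e f he hf h
    obtain ⟨g, g', u, hg, hg', hgg⟩ := hconn e f he hf
    have h1 := T_conj u⁻¹ hg'.trans_one ((T_mono he hg').2 h)
    have h2 : ((u⁻¹ : Aˣ) : A) * g' * ((u⁻¹⁻¹ : Aˣ) : A) = g := by simp [hgg, mul_assoc]
    rw [h2] at h1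
    exact (T_mono hf hg).1 h1
  have T_iff : ∀ {a b c}, OrthTriple a b c → (ψ a * ψ b = 0 ↔ T (a + b)) := by
    intro a b c h
    have hs : ProperSub (a + b) 1 := ProperSub.iff_one.2 ⟨h.add_idem, h.add_ne_zero, h.add_ne_one⟩
    have t := h.properSub_add.orthTriple_one_sub hs
    rw [add_sub_cancel_left] at t
    exact ⟨fun h0 => ⟨a, h.properSub_add, step t h0⟩,
      fun h0 => step t.swap₂₃ (T_all hs h0 h.properSub_add)⟩
  refine or_iff_not_imp_right.2 fun hn => ?_
  push Not at hn
  obtain ⟨a, b, c, h, hab⟩ := hn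
  intro a' b' c' h'
  have hs : ∀ {a b c : A}, OrthTriple a b c → ProperSub (a + b) 1 := fun h =>
    ProperSub.iff_one.2 ⟨h.add_idem, h.add_ne_zero, h.add_ne_one⟩
  exact (T_iff h').2 (T_imp (hs h) (hs h') ((T_iff h).1 hab))

end Orthogonal

theorem eq_or_mul_eq_one_of_mem_pair {z₁ z₂ z₃ z₄ : Prop} {c d m n : ℂ} (hc0 : c ≠ 0) (hd0 : d ≠ 0)
    (hc : c ^ 2 ≠ 1) (hd : d ^ 2 ≠ 1)
    (h₁₂ : z₁ → ¬z₂) (h₁₃ : z₁ → ¬z₃) (h₁₄ : z₁ → ¬z₄) (h₂₃ : z₂ → ¬z₃) (h₂₄ : z₂ → ¬z₄)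
    (h₃₄ : z₃ → ¬z₄) (h₁ : z₁ ∨ c * d = m ∨ c * d = n) (h₂ : z₂ ∨ c = m ∨ c = n)
    (h₃ : z₃ ∨ d = m ∨ d = n) (h₄ : z₄ ∨ 1 = m ∨ 1 = n) :
    (c = d ∨ c * d = 1) ∧ (c = d → z₁ ∨ z₄) := by
  have hc1 : c ≠ 1 := by rintro rfl; simp at hc
  have hd1 : d ≠ 1 := by rintro rfl; simp at hd
  have e1 : c * d ≠ c := fun h => hd1 (mul_left_cancel₀ hc0 (by rw [h, mul_one]))
  have e2 : c * d ≠ d := fun h => hc1 (mul_right_cancel₀ hd0 (by rw [h, one_mul]))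
  have e3 : c = d → c * d ≠ 1 := by rintro rfl; rwa [← sq]
  generalize c * d = x at *
  clear hc hd
  grind

section Algebra

variable {A B : Type*} [Ring A] [Ring B] [Algebra ℂ B] {φ : Aˣ ≃* Bˣ} {c d k : ℂ} {e f g : A}
  {p q r : B}

theorem SpectralImage.exists_mul_eq_smul (t : OrthTriple e f g) (he : SpectralImage φ c e p)
    (hf : SpectralImage φ d f q) (hef : SpectralImage φ k (e + f) r) :
    ∃ m : ℂ, (1 + (c - 1) • p) * (1 + (d - 1) • q) = m • (1 + (k - 1) • r) := by
  obtain ⟨-, u, b, hu, hb, he⟩ := he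
  obtain ⟨-, v, b', hv, hb', hf⟩ := hf
  obtain ⟨b'', hb'', h⟩ := hef.exists_map_eq (u := u * v) (by
    rw [Units.val_mul, hu, hv, add_mul, mul_add, mul_add, t.mul₁₂, one_mul, one_mul, mul_one]
    abel)
  refine ⟨(b * b')⁻¹ * b'', ?_⟩
  rw [mul_smul, ← h, map_mul, Units.val_mul, he, hf, smul_mul_smul_comm,
    inv_smul_smul₀ (mul_ne_zero hb hb')]

end Algebra

section BanachAlgebra

variable {A B : Type*} [NormedRing A] [NormedAlgebra ℂ A] [NormedRing B] [NormedAlgebra ℂ B]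
  [CompleteSpace B] [IsSimpleRing B] {p : B}

theorem exists_spectralImage_eq (φ : Aˣ ≃* Bˣ) (hp : ProperSub p 1) :
    ∃ c : ℂ, c ≠ 0 ∧ ∃ e : A, ProperSub e 1 ∧ SpectralImage φ c e p := by
  have key : (1 - (2 : ℂ) • p) * (1 - (2 : ℂ) • p) = 1 := by
    simp only [mul_sub, sub_mul, mul_one, one_mul, smul_mul_assoc, mul_smul_comm, hp.idem₁.eq]
    module
  let w : Bˣ := ⟨_, _, key, key⟩
  have hw : (w : B) = 1 - (2 : ℂ) • p := rfl
  set v : Aˣ := φ.symm w with hv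
  have hφv : φ v = w := φ.apply_symm_apply w
  have hvv : (v : A) * v = 1 := by
    rw [← Units.val_mul, hv, ← map_mul, (Units.ext key : w * w = 1), map_one, Units.val_one]
  set e : A := (2⁻¹ : ℂ) • (1 - (v : A)) with he
  have hve : (v : A) = 1 - (2 : ℂ) • e := by
    rw [he]; module
  have hei : IsIdempotentElem e := by
    rw [IsIdempotentElem, he]
    simp only [mul_sub, sub_mul, mul_one, one_mul, smul_mul_assoc, mul_smul_comm, hvv]
    module
  have hns : ∀ l : ℂ, (v : A) ≠ l • (1 : A) := fun l hl => by
    obtain ⟨t, ht⟩ := SpectralImage.exists_eq_smul_one_of_map (φ := φ.symm) (u := w) hl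
    rcases hp.idem₁.eq_zero_or_one_of_one_add_smul (s := -2) (t := t) (by norm_num)
      (by rw [← ht, hw]; module) with h | h
    · exact hp.ne_zero h
    · exact hp.ne h
  obtain ⟨c, hc, h⟩ := exists_spectralImage_of_map (φ := φ) hei hp.idem₁ hp.ne_zero hp.ne hve
    (by rw [hφv])
  exact ⟨c, hc, e, ProperSub.iff_one.2 ⟨hei, fun h => hns 1 (by rw [hve, h]; module),
    fun h => hns (-1) (by rw [hve, h]; module)⟩, h⟩

end BanachAlgebra

section BanachAlgebra

variable {A B : Type*} [NormedRing A] [NormedAlgebra ℂ A] [CompleteSpace A] [IsSimpleRing A]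
  [NormedRing B] [NormedAlgebra ℂ B] {φ : Aˣ ≃* Bˣ} {c d k : ℂ} {e f g : A} {p q r : B}

theorem SpectralImage.properSub (h : SpectralImage φ c e p) (he : ProperSub e 1) :
    ProperSub p 1 ∧ c ^ 2 ≠ 1 := by
  obtain ⟨h1, h2, h3⟩ := h.nontrivial he.1 he.ne_zero he.ne
  exact ⟨ProperSub.iff_one.2 ⟨h.1, h1, h2⟩, h3⟩

theorem SpectralImage.eq_or_mul_eq_one_of_same (hs : ProperSub e 1) (h : SpectralImage φ c e p)
    (h' : SpectralImage φ d e q) : c = d ∨ c * d = 1 := by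
  obtain ⟨hp, hc⟩ := h.properSub hs
  obtain ⟨u, hu, -⟩ := hs.idem₁.exists_unit_eq_one_add
  obtain ⟨b, hb, h1⟩ := h.exists_map_eq hu
  obtain ⟨b', hb', h2⟩ := h'.exists_map_eq hu
  have hm : (1 + (c - 1) • p) * (1 + ((1 : ℂ) - 1) • (0 : B)) =
      (b⁻¹ * b') • (1 + (d - 1) • q) := by
    rw [mul_smul, ← h2, h1, inv_smul_smul₀ hb, smul_zero, add_zero, mul_one]
  obtain ⟨-, v2, -, v4⟩ := eigenvalues_of_mul_eq_smul hp.1 .zero h'.1 (by simp) hm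
  rw [sub_zero, mul_one] at v2 v4
  have v2 := v2.resolve_left hp.ne_zero
  have v4 := v4.resolve_left fun h => hp.ne (sub_eq_zero.1 h).symm
  have hc1 : c ≠ 1 := by rintro rfl; simp at hc
  grind

variable [IsSimpleRing B]

theorem SpectralImage.ne_of_orthTriple (t : OrthTriple e f g) (he : SpectralImage φ c e p)
    (hf : SpectralImage φ d f q) : p ≠ q := by
  rintro rfl
  obtain ⟨-, hc⟩ := he.properSub t.properSub_one₁
  obtain ⟨-, u, b, hu, hb, he⟩ := he
  obtain ⟨-, v, b', hv, hb', hf⟩ := hf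
  have hc1 : b * (c - 1) ≠ 0 := mul_ne_zero hb fun h => hc (by rw [sub_eq_zero.1 h, one_pow])
  obtain ⟨α, β, -, hβ⟩ := exists_smul_of_commute_commutant (z := f) t.idem₁ t.ne₁ t.ne_one₁ (by
    intro y hy
    have h1 : y * u = u * y := Units.ext (by
      simp only [Units.val_mul, hu, mul_add, add_mul, mul_one, one_mul, hy])
    have h2 : (φ y : B) * φ u = φ u * φ y := by
      rw [← Units.val_mul, ← map_mul, h1, map_mul, Units.val_mul]
    have h3 : (φ y : B) * p = p * φ y := by
      refine smul_right_injective B hc1 ?_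
      rw [he, ← sub_eq_zero] at h2
      refine sub_eq_zero.1 (Eq.trans ?_ h2)
      simp only [mul_add, add_mul, mul_one, one_mul, smul_mul_assoc, mul_smul_comm]
      module
    have h4 : y * v = v * y := φ.injective (Units.ext (by
      simp only [map_mul, Units.val_mul, hf, mul_add, add_mul, mul_one, one_mul, smul_mul_assoc,
        mul_smul_comm, h3]))
    have h5 := congrArg Units.val h4
    simp only [Units.val_mul, hv, mul_add, add_mul, mul_one, one_mul] at h5
    exact (add_left_cancel h5).symm)
  have h1 : f * (1 - e) = f := by rw [mul_sub, t.mul₂₁, mul_one, sub_zero]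
  have h2 : f = β • f := by
    have := congrArg (f * ·) hβ
    simpa only [h1, t.idem₂.eq, mul_smul_comm] using this
  have h3 : β = 1 := by
    have h4 : (1 - β) • f = 0 := by rw [sub_smul, one_smul, ← h2, sub_self]
    exact (sub_eq_zero.1 ((smul_eq_zero.1 h4).resolve_right t.ne₂)).symm
  rw [h1, h3, one_smul] at hβ
  exact t.add_ne_one (by rw [hβ, add_sub_cancel])

theorem SpectralImage.ne_one_sub_of_orthTriple (t : OrthTriple e f g) (hd : d ≠ 0)
    (he : SpectralImage φ c e p) (hf : SpectralImage φ d f q) : p ≠ 1 - q :=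
  he.ne_of_orthTriple t (hf.flip hd)

theorem SpectralImage.eq_or_mul_eq_one (t : OrthTriple e f g) (hc0 : c ≠ 0) (hd0 : d ≠ 0)
    (he : SpectralImage φ c e p) (hf : SpectralImage φ d f q) (hef : SpectralImage φ k (e + f) r) :
    (c = d ∨ c * d = 1) ∧ (c = d → p * q = 0 ∨ (1 - p) * (1 - q) = 0) := by
  obtain ⟨hp, hc⟩ := he.properSub t.properSub_one₁
  obtain ⟨hq, hd⟩ := hf.properSub t.swap₁₂.properSub_one₁
  have hc1 : c ≠ 1 := by rintro rfl; simp at hc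
  have hd1 : d ≠ 1 := by rintro rfl; simp at hd
  have hpq : p * q = q * p := he.commute hf hc1 hd1 (by rw [t.mul₁₂, t.mul₂₁])
  obtain ⟨m, hm⟩ := exists_mul_eq_smul t he hf hef
  have n1 := he.ne_of_orthTriple t hf
  have n2 := he.ne_one_sub_of_orthTriple t hd0 hf
  obtain ⟨v1, v2, v3, v4⟩ := eigenvalues_of_mul_eq_smul hp.1 hq.1 hef.1 hpq hm
  have e1 : p * (1 - q) = p - p * q := by rw [mul_sub, mul_one]
  have e2 : (1 - p) * q = q - p * q := by rw [sub_mul, one_mul]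
  have e3 : (1 - p) * (1 - q) = 1 - p - (q - p * q) := by
    rw [mul_sub, mul_one, sub_mul, one_mul]
  rw [e1] at v2
  rw [e2] at v3
  rw [e3] at v4 ⊢
  have p0 := hp.ne_zero
  have p1 := hp.ne
  have q0 := hq.ne_zero
  have q1 := hq.ne
  have m12 : p * q = 0 → p - p * q ≠ 0 := fun h h' => p0 (by rw [h, sub_zero] at h'; exact h')
  have m13 : p * q = 0 → q - p * q ≠ 0 := fun h h' => q0 (by rw [h, sub_zero] at h'; exact h')
  have m14 : p * q = 0 → 1 - p - (q - p * q) ≠ 0 := fun h h' => n2 (by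
    rw [h, sub_zero, sub_sub, add_comm, ← sub_sub] at h'; exact (sub_eq_zero.1 h').symm)
  have m23 : p - p * q = 0 → q - p * q ≠ 0 := fun h h' => n1 (by
    rw [sub_eq_zero.1 h, ← sub_eq_zero.1 h'])
  have m24 : p - p * q = 0 → 1 - p - (q - p * q) ≠ 0 := fun h h' => q1 (by
    rw [← sub_eq_zero.1 h, sub_sub, add_sub_cancel] at h'; exact (sub_eq_zero.1 h').symm)
  have m34 : q - p * q = 0 → 1 - p - (q - p * q) ≠ 0 := fun h h' => p1 (by
    rw [h, sub_zero] at h'; exact (sub_eq_zero.1 h').symm)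
  exact eq_or_mul_eq_one_of_mem_pair hc0 hd0 hc hd m12 m13 m14 m23 m24 m34 v1 v2 v3 v4

variable [CompleteSpace B]

theorem exists_spectralImage_of_properSub (φ : Aˣ ≃* Bˣ) (he : ProperSub e 1) :
    ∃ c : ℂ, c ≠ 0 ∧ ∃ p : B, SpectralImage φ c e p := by
  have key : (1 - (2 : ℂ) • e) * (1 - (2 : ℂ) • e) = 1 := by
    simp only [mul_sub, sub_mul, mul_one, one_mul, smul_mul_assoc, mul_smul_comm, he.idem₁.eq]
    module
  let v : Aˣ := ⟨_, _, key, key⟩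
  have hv : (v : A) = 1 - (2 : ℂ) • e := rfl
  have hw : (φ v : B) * φ v = 1 := by
    rw [← Units.val_mul, ← map_mul, (Units.ext key : v * v = 1), map_one, Units.val_one]
  set p : B := (2⁻¹ : ℂ) • (1 - (φ v : B)) with hp
  have hvp : (φ v : B) = 1 - (2 : ℂ) • p := by
    rw [hp]; module
  have hpi : IsIdempotentElem p := by
    rw [IsIdempotentElem, hp]
    simp only [mul_sub, sub_mul, mul_one, one_mul, smul_mul_assoc, mul_smul_comm, hw]
    module
  have hns : ∀ l : ℂ, (φ v : B) ≠ l • (1 : B) := fun l hl => by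
    obtain ⟨t, ht⟩ := SpectralImage.exists_eq_smul_one_of_map hl
    rcases he.idem₁.eq_zero_or_one_of_one_add_smul (s := -2) (t := t) (by norm_num)
      (by rw [← ht, hv]; module) with h | h
    · exact he.ne_zero h
    · exact he.ne h
  obtain ⟨c, hc, h⟩ := exists_spectralImage_of_map (φ := φ) he.idem₁ hpi
    (fun h => hns 1 (by rw [hvp, h]; module)) (fun h => hns (-1) (by rw [hvp, h]; module)) hv hvp
  exact ⟨c, hc, p, h⟩

namespace SpectralImage

theorem exists_of_orthTriple (t : OrthTriple e f g) (hc : c ≠ 0) (h : SpectralImage φ c e p) :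
    ∃ q : B, SpectralImage φ c f q := by
  obtain ⟨d, hd, q, hq⟩ := exists_spectralImage_of_properSub φ t.swap₁₂.properSub_one₁
  obtain ⟨k, hk, r, hr⟩ := exists_spectralImage_of_properSub φ t.properSub_one_add
  rcases (h.eq_or_mul_eq_one t hc hd hq hr).1 with rfl | hcd
  · exact ⟨q, hq⟩
  · rw [eq_inv_of_mul_eq_one_left hcd]
    exact ⟨_, hq.flip hd⟩

theorem exists_iff_of_properSub (hfe : ProperSub f e) (hs : ProperSub e 1) (hc : c ≠ 0) :
    (∃ q : B, SpectralImage φ c f q) ↔ ∃ p : B, SpectralImage φ c e p := by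
  have t := hfe.orthTriple_one_sub hs
  constructor
  · rintro ⟨q, hq⟩
    obtain ⟨p, hp⟩ := hq.exists_of_orthTriple t.swap₂₃ hc
    have := hp.compl hc t.idem₃
    rw [sub_sub_cancel] at this
    exact ⟨_, this⟩
  · rintro ⟨p, hp⟩
    exact (hp.compl hc hs.idem₁).exists_of_orthTriple t.swap₂₃.swap₁₂ hc

end SpectralImage

/-- There is a consistent choice of spectral idempotents of the elements `φ (1 + e)` that
preserves orthogonality. -/
theorem exists_spectralImage_mul_eq_zero (φ : Aˣ ≃* Bˣ)
    (hconn : ∀ e f : A, ProperSub e 1 → ProperSub f 1 → ∃ (g g' : A) (u : Aˣ),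
      ProperSub g f ∧ ProperSub g' e ∧ g' = u * g * ((u⁻¹ : Aˣ) : A)) :
    ∃ (c : ℂ) (ψ : A → B), c ≠ 0 ∧ (∀ e, ProperSub e 1 → SpectralImage φ c e (ψ e)) ∧
      ∀ e f g, OrthTriple e f g → ψ e * ψ f = 0 := by
  by_cases hex : ∃ e : A, ProperSub e 1
  swap
  · exact ⟨1, 0, one_ne_zero, fun e he => absurd ⟨e, he⟩ hex, fun e f g t => by simp⟩
  obtain ⟨e₀, he₀⟩ := hex
  obtain ⟨c, hc, p₀, hp₀⟩ := exists_spectralImage_of_properSub φ he₀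
  have hall : ∀ e : A, ∃ p : B, ProperSub e 1 → SpectralImage φ c e p := by
    intro e
    by_cases he : ProperSub e 1
    swap
    · exact ⟨0, fun h => absurd h he⟩
    obtain ⟨g, g', u, hg, hg', hgg⟩ := hconn e₀ e he₀ he
    obtain ⟨q, hq⟩ := (SpectralImage.exists_iff_of_properSub hg' he₀ hc).2 ⟨p₀, hp₀⟩
    have h1 := hq.conj u⁻¹
    have h2 : ((u⁻¹ : Aˣ) : A) * g' * ((u⁻¹⁻¹ : Aˣ) : A) = g := by simp [hgg, mul_assoc]
    rw [h2] at h1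
    obtain ⟨p, hp⟩ := (SpectralImage.exists_iff_of_properSub hg he hc).1 ⟨_, h1⟩
    exact ⟨p, fun _ => hp⟩
  choose ψ hψ using hall
  have hc1 : c ≠ 1 := by
    rintro rfl
    simpa using ((hψ e₀ he₀).properSub he₀).2
  have hdich : ∀ a b d, OrthTriple a b d → ψ a * ψ b = 0 ∨ (1 - ψ a) * (1 - ψ b) = 0 :=
    fun a b d t => ((hψ a t.properSub_one₁).eq_or_mul_eq_one t hc hc
      (hψ b t.swap₁₂.properSub_one₁) (hψ _ t.properSub_one_add)).2 rfl
  rcases forall_mul_eq_zero_or_forall_mul_ne_zero (ψ := ψ)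
    (fun a b d t => (hψ a t.properSub_one₁).commute (hψ b t.swap₁₂.properSub_one₁) hc1 hc1
      (by rw [t.mul₁₂, t.mul₂₁]))
    (fun e he => ⟨((hψ e he).properSub he).1.ne_zero, ((hψ e he).properSub he).1.ne⟩)
    hdich
    (fun u a b ha hb hab => by
      have key : ∀ a, ProperSub a 1 → ψ (u * a * ((u⁻¹ : Aˣ) : A)) =
          (φ u : B) * ψ a * (((φ u)⁻¹ : Bˣ) : B) := fun a ha => by
        have hs := ha.conj u
        rw [mul_one, Units.mul_inv] at hs
        exact (hψ _ hs).unique ((hψ a ha).conj u) hs.1 hs.ne_zero hs.ne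
      rw [key a ha, key b hb]
      simp only [← mul_assoc, Units.inv_mul_cancel_right]
      rw [mul_assoc (φ u : B), hab, mul_zero, zero_mul])
    hconn with h | h
  · exact ⟨c, ψ, hc, hψ, h⟩
  · exact ⟨c⁻¹, fun e => 1 - ψ e, inv_ne_zero hc, fun e he => (hψ e he).flip hc,
      fun a b d t => (hdich a b d t).resolve_left (h a b d t)⟩

end BanachAlgebra

theorem OddlyDecomposable.exists_properSub {A : Type*} [Ring A] (h : OddlyDecomposable A) {e f : A}
    (he : ProperSub e 1) (hf : ProperSub f 1) : ∃ (g g' : A) (u : Aˣ),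
      ProperSub g f ∧ ProperSub g' e ∧ g' = u * g * ((u⁻¹ : Aˣ) : A) := by
  obtain ⟨n, -, hn, g, hg, horth, hsum, hsub⟩ :=
    h e f he.1 he.ne_zero he.ne hf.1 hf.ne_zero hf.ne
  let i : Fin n := ⟨0, by omega⟩
  let j : Fin n := ⟨1, by omega⟩
  have hij : i ≠ j := by simp [i, j]
  obtain ⟨g', u, hg', h0, -, hu, h1, h2, h3⟩ := hsub i
  have hl : ∀ k, g k * f = g k := fun k => by
    rw [← hsum, Finset.mul_sum, Finset.sum_eq_single k (fun l _ hl => horth k l hl.symm) (by simp)]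
    exact (hg k).1.eq
  have hr : ∀ k, f * g k = g k := fun k => by
    rw [← hsum, Finset.sum_mul, Finset.sum_eq_single k (fun l _ hl => horth l k hl) (by simp)]
    exact (hg k).1.eq
  refine ⟨g i, g', u, ⟨(hg i).1, hf.1, hl i, hr i, (hg i).2.1, fun hif => ?_⟩,
    ⟨hg', he.1, h1, h2, h0, h3⟩, hu⟩
  have := hr j
  rw [← hif, horth i j hij] at this
  exact (hg j).2.1 this.symm

theorem statement17 [IsSimpleRing A] [IsSimpleRing B]
    (hA : OddlyDecomposable A) (φ : Aˣ ≃* Bˣ) :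
    ∃ Θ : A → B,
      Set.BijOn Θ {e : A | IsIdempotentElem e} {f : B | IsIdempotentElem f} ∧
      Θ 0 = 0 ∧ Θ 1 = 1 ∧
      (∀ e f : A, IsIdempotentElem e → IsIdempotentElem f → e * f = f * e →
        Θ e * Θ f = Θ f * Θ e ∧ (e * f = 0 ↔ Θ e * Θ f = 0)) ∧
      (∀ e f : A, IsIdempotentElem e → IsIdempotentElem f →
        ((∃ u : Aˣ, f = (u : A) * e * ((u⁻¹ : Aˣ) : A)) ↔
          (∃ v : Bˣ, Θ f = (v : B) * Θ e * ((v⁻¹ : Bˣ) : B)))) := by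
  classical
  obtain ⟨c, ψ, hc, hψ, horth⟩ :=
    exists_spectralImage_mul_eq_zero φ fun e f he hf => hA.exists_properSub he hf
  let Θ : A → B := fun e => if e = 0 then 0 else if e = 1 then 1 else ψ e
  have h0 : Θ 0 = 0 := if_pos rfl
  have h1 : Θ 1 = 1 := by simp [Θ]
  have hΘ : ∀ e, ProperSub e 1 → Θ e = ψ e := fun e he => by simp [Θ, he.ne_zero, he.ne]
  have hcases : ∀ e : A, IsIdempotentElem e → e = 0 ∨ e = 1 ∨ ProperSub e 1 := fun e he => by
    by_cases e0 : e = 0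
    · exact Or.inl e0
    by_cases e1 : e = 1
    · exact Or.inr (Or.inl e1)
    exact Or.inr (Or.inr (ProperSub.iff_one.2 ⟨he, e0, e1⟩))
  have hprop : ∀ e, ProperSub e 1 → ProperSub (ψ e) 1 := fun e he => ((hψ e he).properSub he).1
  have hc1 : ∀ e : A, ProperSub e 1 → c ≠ 1 := by
    rintro e he rfl
    simpa using ((hψ e he).properSub he).2
  have hidem : ∀ e : A, IsIdempotentElem e → IsIdempotentElem (Θ e) := fun e he => by
    rcases hcases e he with rfl | rfl | hp
    · rw [h0]; exact .zero
    · rw [h1]; exact .one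
    · rw [hΘ e hp]; exact (hprop e hp).1
  have hcompl : ∀ e : A, IsIdempotentElem e → Θ (1 - e) = 1 - Θ e := fun e he => by
    rcases hcases e he with rfl | rfl | hp
    · rw [h0, sub_zero, sub_zero, h1]
    · rw [h1, sub_self, sub_self, h0]
    · rw [hΘ e hp, hΘ _ hp.sub]
      exact (hψ _ hp.sub).unique ((hψ e hp).compl hc hp.1) hp.sub.1 hp.sub.ne_zero hp.sub.ne
  have hinj : Set.InjOn Θ {e : A | IsIdempotentElem e} := fun e he f hf hef => by
    rcases hcases e he with rfl | rfl | hp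
    · rcases hcases f hf with rfl | rfl | hq
      · rfl
      · exact absurd (h0.symm.trans (hef.trans h1)) zero_ne_one
      · exact absurd ((hΘ f hq).symm.trans (hef.symm.trans h0)) (hprop f hq).ne_zero
    · rcases hcases f hf with rfl | rfl | hq
      · exact absurd (h1.symm.trans (hef.trans h0)) one_ne_zero
      · rfl
      · exact absurd ((hΘ f hq).symm.trans (hef.symm.trans h1)) (hprop f hq).ne
    · rcases hcases f hf with rfl | rfl | hq
      · exact absurd ((hΘ e hp).symm.trans (hef.trans h0)) (hprop e hp).ne_zero
      · exact absurd ((hΘ e hp).symm.trans (hef.trans h1)) (hprop e hp).ne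
      · rw [hΘ e hp, hΘ f hq] at hef
        exact (hψ e hp).injective (hef ▸ hψ f hq) he hf hp.ne_zero hp.ne
  have hsurj : Set.SurjOn Θ {e : A | IsIdempotentElem e} {f : B | IsIdempotentElem f} := by
    intro p hp
    by_cases p0 : p = 0
    · exact ⟨0, .zero, by rw [h0, p0]⟩
    by_cases p1 : p = 1
    · exact ⟨1, .one, by rw [h1, p1]⟩
    obtain ⟨k, hk, e, he, hkp⟩ :=
      exists_spectralImage_eq φ (ProperSub.iff_one.2 ⟨hp, p0, p1⟩)
    rcases hkp.eq_or_mul_eq_one_of_same he (hψ e he) with rfl | hkc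
    · exact ⟨e, he.1, (hΘ e he).trans ((hψ e he).unique hkp he.1 he.ne_zero he.ne)⟩
    · have hflip := hkp.flip hk
      rw [← eq_inv_of_mul_eq_one_right hkc] at hflip
      refine ⟨1 - e, he.sub.1, ?_⟩
      rw [hcompl e he.1, hΘ e he, (hψ e he).unique hflip he.1 he.ne_zero he.ne, sub_sub_cancel]
  have hcomm : ∀ e f : A, IsIdempotentElem e → IsIdempotentElem f → e * f = f * e →
      Θ e * Θ f = Θ f * Θ e := fun e f he hf hef => by
    rcases hcases e he with rfl | rfl | hp
    · simp [h0]
    · simp [h1]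
    rcases hcases f hf with rfl | rfl | hq
    · simp [h0]
    · simp [h1]
    rw [hΘ e hp, hΘ f hq]
    exact (hψ e hp).commute (hψ f hq) (hc1 e hp) (hc1 e hp) hef
  have hmul : ∀ e f : A, IsIdempotentElem e → IsIdempotentElem f → e * f = 0 → f * e = 0 →
      Θ e * Θ f = 0 := fun e f he hf hef hfe => by
    rcases hcases e he with rfl | rfl | hp
    · rw [h0, zero_mul]
    · rw [← one_mul f, hef, h0, mul_zero]
    rcases hcases f hf with rfl | rfl | hq
    · rw [h0, mul_zero]
    · exact absurd ((mul_one e).symm.trans hef) hp.ne_zero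
    by_cases hs : e = 1 - f
    · rw [hs, hcompl f hf, sub_mul, one_mul, (hidem f hf).eq, sub_self]
    have hsub : ProperSub e (1 - f) :=
      ⟨he, hq.sub.1, by rw [mul_sub, mul_one, hef, sub_zero],
        by rw [sub_mul, one_mul, hfe, sub_zero], hp.ne_zero, hs⟩
    have t := hsub.orthTriple hf hq.ne_zero hf.one_sub_mul_self hf.mul_one_sub_self
    rw [hΘ e hp, hΘ f hq]
    exact horth _ _ _ t.swap₂₃
  have hconj : ∀ (u : Aˣ) (e : A), IsIdempotentElem e →
      Θ (u * e * ((u⁻¹ : Aˣ) : A)) = (φ u : B) * Θ e * (((φ u)⁻¹ : Bˣ) : B) := fun u e he => by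
    rcases hcases e he with rfl | rfl | hp
    · simp [h0]
    · simp [h1]
    have hs := hp.conj u
    rw [mul_one, Units.mul_inv] at hs
    rw [hΘ e hp, hΘ _ hs]
    exact (hψ _ hs).unique ((hψ e hp).conj u) hs.1 hs.ne_zero hs.ne
  refine ⟨Θ, ⟨hidem, hinj, hsurj⟩, h0, h1, fun e f he hf hef => ⟨hcomm e f he hf hef,
    fun h => hmul e f he hf h (hef ▸ h), fun h => ?_⟩, fun e f he hf => ⟨?_, ?_⟩⟩
  · have hi : IsIdempotentElem (e * f) := he.mul_of_commute hef hf
    have key : ∀ a : A, IsIdempotentElem a → e * f * a = e * f → a * (e * f) = e * f →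
        Θ (e * f) * Θ a = Θ (e * f) := fun a ha hl hr => by
      have := hmul (e * f) (1 - a) hi ha.one_sub (by rw [mul_sub, mul_one, hl, sub_self])
        (by rw [sub_mul, one_mul, hr, sub_self])
      rw [hcompl a ha, mul_sub, mul_one] at this
      exact (sub_eq_zero.1 this).symm
    have k1 := key e he (by rw [hef, mul_assoc, he.eq]) (by rw [← mul_assoc, he.eq])
    have k2 := key f hf (by rw [mul_assoc, hf.eq]) (by rw [hef, ← mul_assoc, hf.eq])
    refine hinj hi .zero ?_
    rw [h0, ← k2, ← k1, mul_assoc, h, mul_zero]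
  · rintro ⟨u, rfl⟩
    exact ⟨φ u, hconj u e he⟩
  · rintro ⟨v, hv⟩
    refine ⟨φ.symm v, hinj hf ?_ ?_⟩
    · simp only [Set.mem_ofPred_eq, IsIdempotentElem, ← mul_assoc, Units.inv_mul_cancel_right]
      rw [mul_assoc _ e e, he.eq]
    · rw [hconj _ e he, φ.apply_symm_apply, hv]

end
end

section
/- Let A be a simple unital complex C*-algebra which is purely infinite, in the sense that for every nonzero a ∈ A there exist x, y ∈ A with x a y = 1. Then A is oddly decomposable: for every pair of nontrivial idempotents e, f ∈ Ĩ(A) there is an odd integer n ≥ 3 and n pairwise orthogonal idempotents g₁,…,g_n ∈ Ĩ(A) with g₁+⋯+g_n = f, such that each g_i is similar to some g_i' ∈ Ĩ(A) with g_i'e = eg_i' = g_i' ≠ e. -/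
noncomputable section

section PurelyInfinite

variable {R : Type*} [Ring R]

/-- The left ideal of elements fixed by right multiplication by `a`; it is `R a` when `a` is
idempotent. -/
def rightFixed (a : R) : Submodule R R where
  carrier := {x | x * a = x}
  add_mem' := fun {x y} hx hy => by
    simp only [Set.mem_ofPred_eq] at hx hy ⊢
    rw [add_mul, hx, hy]
  zero_mem' := zero_mul a
  smul_mem' := fun c x hx => by
    simp only [Set.mem_ofPred_eq, smul_eq_mul] at hx ⊢
    rw [mul_assoc, hx]

theorem mem_rightFixed {a x : R} : x ∈ rightFixed a ↔ x * a = x := Iff.rfl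

/-- Mutually inverse right multiplications between `R a` and `R b`. -/
def rightFixedEquiv {a b s t : R} (hsb : s * b = s) (hta : t * a = t)
    (hst : s * t = a) (hts : t * s = b) : rightFixed a ≃ₗ[R] rightFixed b where
  toFun x := ⟨x * s, by rw [mem_rightFixed, mul_assoc, hsb]⟩
  invFun y := ⟨y * t, by rw [mem_rightFixed, mul_assoc, hta]⟩
  map_add' x y := Subtype.ext (add_mul _ _ _)
  map_smul' c x := Subtype.ext (mul_assoc _ _ _)
  left_inv x := Subtype.ext (by simp only [mul_assoc, hst]; exact x.2)
  right_inv y := Subtype.ext (by simp only [mul_assoc, hts]; exact y.2)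

theorem conj_embedding_ne {a b s t : R} (hts : t * s = 1) (has : a * s = s)
    (hst : s * t ≠ a) : s * b * t ≠ a := fun h => hst <| by
  calc s * t = a * s * t := by rw [has]
    _ = s * b * (t * s) * t := by rw [← h]; noncomm_ring
    _ = a := by rw [hts, mul_one, h]

theorem conj_embedding_idem {b s t : R} (hb : IsIdempotentElem b) (hts : t * s = 1) :
    IsIdempotentElem (s * b * t) := by
  calc s * b * t * (s * b * t) = s * b * (t * s) * b * t := by noncomm_ring
    _ = s * (b * b) * t := by rw [hts]; noncomm_ring
    _ = s * b * t := by rw [hb.eq]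

theorem conj_embedding_ne_zero {b s t : R} (hb0 : b ≠ 0) (hts : t * s = 1) :
    s * b * t ≠ 0 := fun h => hb0 <| by
  calc b = (t * s) * b * (t * s) := by rw [hts, one_mul, mul_one]
    _ = t * (s * b * t) * s := by noncomm_ring
    _ = 0 := by rw [h, mul_zero, zero_mul]

theorem sub_conj_embedding_idem {a b s t : R} (ha : IsIdempotentElem a)
    (hb : IsIdempotentElem b) (hts : t * s = 1) (has : a * s = s) (hta : t * a = t) :
    IsIdempotentElem (a - s * b * t) := by
  have h₁ : a * (s * b * t) = s * b * t := by simp only [← mul_assoc, has]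
  have h₂ : s * b * t * a = s * b * t := by rw [mul_assoc, hta]
  have h₃ := (conj_embedding_idem hb hts).eq
  rw [IsIdempotentElem, sub_mul, mul_sub, mul_sub, h₁, h₂, h₃, ha.eq]; abel

/-- If `s, t` embed `1` below `a`, then `R a` splits as `R b ⊕ R (a - s b t)`. -/
def rightFixedSplit {a b s t : R} (ha : IsIdempotentElem a) (hb : IsIdempotentElem b)
    (hts : t * s = 1) (has : a * s = s) (hta : t * a = t) :
    rightFixed a ≃ₗ[R] rightFixed b × rightFixed (a - s * b * t) where
  toFun x := (⟨x * (s * b), by rw [mem_rightFixed, mul_assoc, mul_assoc, hb.eq]⟩,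
    ⟨x * (a - s * b * t), by
      rw [mem_rightFixed, mul_assoc, (sub_conj_embedding_idem ha hb hts has hta).eq]⟩)
  invFun y := ⟨y.1 * t + y.2, by
    have h₁ : (a - s * b * t) * a = a - s * b * t := by
      rw [sub_mul, ha.eq, mul_assoc, hta]
    have h₂ : (y.2 : R) * a = y.2 := by
      have := mem_rightFixed.1 y.2.2
      rw [← this, mul_assoc, h₁]
    rw [mem_rightFixed, add_mul, mul_assoc, hta, h₂]⟩
  map_add' x y := Prod.ext (Subtype.ext (add_mul _ _ _)) (Subtype.ext (add_mul _ _ _))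
  map_smul' c x := Prod.ext (Subtype.ext (mul_assoc _ _ _)) (Subtype.ext (mul_assoc _ _ _))
  left_inv x := Subtype.ext (by
    have hx := mem_rightFixed.1 x.2
    calc (x : R) * (s * b) * t + x * (a - s * b * t) = x * a := by noncomm_ring
      _ = x := hx)
  right_inv y := by
    have hy₁ := mem_rightFixed.1 y.1.2
    have hy₂ := mem_rightFixed.1 y.2.2
    have h₁ : (a - s * b * t) * (s * b) = 0 := by
      calc (a - s * b * t) * (s * b) = (a * s) * b - s * b * (t * s) * b := by noncomm_ring
        _ = s * b - s * (b * b) := by rw [has, hts]; noncomm_ring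
        _ = 0 := by rw [hb.eq, sub_self]
    refine Prod.ext (Subtype.ext ?_) (Subtype.ext ?_)
    · calc ((y.1 : R) * t + y.2) * (s * b)
          = y.1 * (t * s) * b + y.2 * (s * b) := by noncomm_ring
        _ = y.1 * b + y.2 * (a - s * b * t) * (s * b) := by rw [hts, mul_one, hy₂]
        _ = y.1 := by rw [mul_assoc _ _ (s * b), h₁, mul_zero, add_zero, hy₁]
    · calc ((y.1 : R) * t + y.2) * (a - s * b * t)
          = y.1 * (t * a) - y.1 * (t * s) * b * t + y.2 * (a - s * b * t) := by noncomm_ring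
        _ = y.2 := by rw [hta, hts, mul_one, hy₁, hy₂, sub_self, zero_add]

/-- `R` is the direct sum of `R a` and `R (1 - a)`. -/
def rightFixedCompl {a : R} (ha : IsIdempotentElem a) :
    R ≃ₗ[R] rightFixed a × rightFixed (1 - a) where
  toFun x := (⟨x * a, by rw [mem_rightFixed, mul_assoc, ha.eq]⟩,
    ⟨x * (1 - a), by rw [mem_rightFixed, mul_assoc, ha.one_sub.eq]⟩)
  invFun y := y.1 + y.2
  map_add' x y := Prod.ext (Subtype.ext (add_mul _ _ _)) (Subtype.ext (add_mul _ _ _))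
  map_smul' c x := Prod.ext (Subtype.ext (mul_assoc _ _ _)) (Subtype.ext (mul_assoc _ _ _))
  left_inv x := by
    change x * a + x * (1 - a) = x
    noncomm_ring
  right_inv y := by
    have hy₁ := mem_rightFixed.1 y.1.2
    have hy₂ := mem_rightFixed.1 y.2.2
    have h₁ : (y.1 : R) * (1 - a) = 0 := by rw [mul_sub, mul_one, hy₁, sub_self]
    have h₂ : (y.2 : R) * a = 0 := by
      rw [mul_sub, mul_one] at hy₂
      exact sub_eq_self.1 hy₂
    refine Prod.ext (Subtype.ext ?_) (Subtype.ext ?_)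
    · change ((y.1 : R) + y.2) * a = y.1
      rw [add_mul, hy₁, h₂, add_zero]
    · change ((y.1 : R) + y.2) * (1 - a) = y.2
      rw [add_mul, hy₂, h₁, zero_add]

/-- Idempotents generating isomorphic left ideals with isomorphic complements are similar. -/
theorem exists_unit_conj {a b : R} (ha : IsIdempotentElem a) (hb : IsIdempotentElem b)
    (φ : rightFixed a ≃ₗ[R] rightFixed b) (ψ : rightFixed (1 - a) ≃ₗ[R] rightFixed (1 - b)) :
    ∃ u : Rˣ, b = u * a * ((u⁻¹ : Rˣ) : R) := by
  let Φ : R ≃ₗ[R] R := (rightFixedCompl ha).trans ((φ.prodCongr ψ).trans (rightFixedCompl hb).symm)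
  have hΦ (x : R) : Φ x = x * Φ 1 := by
    conv_lhs => rw [← mul_one x, ← smul_eq_mul, map_smul, smul_eq_mul]
  have hΦs (x : R) : Φ.symm x = x * Φ.symm 1 := by
    conv_lhs => rw [← mul_one x, ← smul_eq_mul, map_smul, smul_eq_mul]
  have h₁ : Φ 1 * Φ.symm 1 = 1 := by rw [← hΦs, Φ.symm_apply_apply]
  have h₂ : Φ.symm 1 * Φ 1 = 1 := by rw [← hΦ, Φ.apply_symm_apply]
  have key (x : R) : Φ (x * a) = Φ x * b := by
    have e₁ (x : R) : Φ x * b = φ ((rightFixedCompl ha x).1) := by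
      have := congrArg Prod.fst ((rightFixedCompl hb).apply_symm_apply
        ((φ.prodCongr ψ) (rightFixedCompl ha x)))
      exact congrArg Subtype.val this
    have e₂ : rightFixedCompl ha (x * a) = ((rightFixedCompl ha x).1, 0) := by
      refine Prod.ext (Subtype.ext ?_) (Subtype.ext ?_)
      · change x * a * a = x * a
        rw [mul_assoc, ha.eq]
      · change x * a * (1 - a) = 0
        rw [mul_assoc, ha.mul_one_sub_self, mul_zero]
    rw [e₁]
    change (rightFixedCompl hb).symm ((φ.prodCongr ψ) (rightFixedCompl ha (x * a))) = _
    rw [e₂]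
    change ((φ (rightFixedCompl ha x).1 : R) + (ψ 0 : R)) = _
    rw [map_zero, ZeroMemClass.coe_zero, add_zero]
  refine ⟨⟨Φ.symm 1, Φ 1, h₂, h₁⟩, ?_⟩
  change b = Φ.symm 1 * a * Φ 1
  rw [← hΦ, key, Φ.apply_symm_apply, one_mul]

/-- In a purely infinite ring with a nontrivial idempotent, `1` is equivalent to a proper
subidempotent of any nonzero idempotent. -/
theorem exists_proper_embedding (hpi : ∀ a : R, a ≠ 0 → ∃ x y : R, x * a * y = 1)
    {e : R} (he : IsIdempotentElem e) (he0 : e ≠ 0) (he1 : e ≠ 1)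
    {a : R} (ha : IsIdempotentElem a) (ha0 : a ≠ 0) :
    ∃ s t : R, t * s = 1 ∧ a * s = s ∧ t * a = t ∧ s * t ≠ a := by
  obtain ⟨x, y, hxy⟩ := hpi a ha0
  obtain ⟨z, w, hzw⟩ := hpi e he0
  refine ⟨a * y * (e * w), z * e * (x * a), ?_, ?_, ?_, fun h => he1 ?_⟩
  · calc z * e * (x * a) * (a * y * (e * w)) = z * e * (x * (a * a) * y) * e * w := by
          noncomm_ring
      _ = z * (e * e) * w := by rw [ha.eq, hxy]; noncomm_ring
      _ = 1 := by rw [he.eq, hzw]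
  · simp only [← mul_assoc, ha.eq]
  · simp only [mul_assoc, ha.eq]
  · have h₁ : e * w * (z * e) = 1 := by
      calc e * w * (z * e) = (x * a * y) * (e * w * (z * e)) * (x * a * y) := by
            rw [hxy]; noncomm_ring
        _ = x * (a * y * (e * w) * (z * e * (x * a))) * y := by noncomm_ring
        _ = 1 := by rw [h, hxy]
    calc e = e * (e * w * (z * e)) := by rw [h₁, mul_one]
      _ = e * e * w * (z * e) := by noncomm_ring
      _ = 1 := by rw [he.eq, h₁]

theorem exists_rightFixed_split (hpi : ∀ a : R, a ≠ 0 → ∃ x y : R, x * a * y = 1)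
    {e : R} (he : IsIdempotentElem e) (he0 : e ≠ 0) (he1 : e ≠ 1)
    {a b : R} (ha : IsIdempotentElem a) (ha0 : a ≠ 0) (hb : IsIdempotentElem b) :
    ∃ h : R, IsIdempotentElem h ∧ h ≠ 0 ∧
      Nonempty (rightFixed a ≃ₗ[R] rightFixed b × rightFixed h) := by
  obtain ⟨s, t, hts, has, hta, hst⟩ := exists_proper_embedding hpi he he0 he1 ha ha0
  exact ⟨a - s * b * t, sub_conj_embedding_idem ha hb hts has hta,
    sub_ne_zero.2 (conj_embedding_ne hts has hst).symm,
    ⟨rightFixedSplit ha hb hts has hta⟩⟩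

/-- A splitting of `Z` as `G × W` regroups `N × Z` as `(G × N) × W`. -/
def prodEquivOfSplit (N : Type*) {G Z W : Type*} [AddCommGroup N] [AddCommGroup G]
    [AddCommGroup Z] [AddCommGroup W] [Module R N] [Module R G] [Module R Z] [Module R W]
    (γ : Z ≃ₗ[R] G × W) : (N × Z) ≃ₗ[R] (G × N) × W :=
  (LinearEquiv.refl R N).prodCongr γ ≪≫ₗ (LinearEquiv.prodAssoc R N G W).symm ≪≫ₗ
    (LinearEquiv.prodComm R N G).prodCongr (.refl R W)

/-- Cancellation of a common summand `G` of two modules, when `M` absorbs a module containing `G`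
and `M` is a summand of `M'`. -/
theorem nonempty_equiv_of_absorb {M M' G Z Y W : Type*} [AddCommGroup M] [AddCommGroup M']
    [AddCommGroup G] [AddCommGroup Z] [AddCommGroup Y] [AddCommGroup W] [Module R M]
    [Module R M'] [Module R G] [Module R Z] [Module R Y] [Module R W]
    (α : M ≃ₗ[R] M × Z) (β : M' ≃ₗ[R] M × Y) (γ : Z ≃ₗ[R] G × W)
    (δ : (G × M) ≃ₗ[R] G × M') : Nonempty (M ≃ₗ[R] M') := by
  have absorb : M' ≃ₗ[R] M' × Z :=
    β ≪≫ₗ α.prodCongr (.refl R Y) ≪≫ₗ .prodAssoc R M Z Y ≪≫ₗ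
      (LinearEquiv.refl R M).prodCongr (.prodComm R Z Y) ≪≫ₗ
      (LinearEquiv.prodAssoc R M Y Z).symm ≪≫ₗ β.symm.prodCongr (.refl R Z)
  exact ⟨α ≪≫ₗ prodEquivOfSplit M γ ≪≫ₗ δ.prodCongr (.refl R W) ≪≫ₗ
    (prodEquivOfSplit M' γ).symm ≪≫ₗ absorb.symm⟩

/-- Nonzero complements of equivalent idempotents are equivalent in a purely infinite ring. -/
theorem nonempty_rightFixed_compl_equiv (hpi : ∀ a : R, a ≠ 0 → ∃ x y : R, x * a * y = 1)
    {g g' : R} (hg : IsIdempotentElem g) (hg0 : g ≠ 0) (hg1 : g ≠ 1)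
    (hg' : IsIdempotentElem g') (hg1' : g' ≠ 1) (φ : rightFixed g ≃ₗ[R] rightFixed g') :
    Nonempty (rightFixed (1 - g) ≃ₗ[R] rightFixed (1 - g')) := by
  have hc0 : 1 - g ≠ 0 := sub_ne_zero.2 hg1.symm
  have hc0' : 1 - g' ≠ 0 := sub_ne_zero.2 hg1'.symm
  obtain ⟨z, hz, hz0, ⟨α⟩⟩ :=
    exists_rightFixed_split hpi hg hg0 hg1 hg.one_sub hc0 hg.one_sub
  obtain ⟨y, -, -, ⟨β⟩⟩ :=
    exists_rightFixed_split hpi hg hg0 hg1 hg'.one_sub hc0' hg.one_sub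
  obtain ⟨w, -, -, ⟨γ⟩⟩ := exists_rightFixed_split hpi hg hg0 hg1 hz hz0 hg
  exact nonempty_equiv_of_absorb α β γ
    ((rightFixedCompl hg).symm ≪≫ₗ rightFixedCompl hg' ≪≫ₗ φ.symm.prodCongr (.refl R _))

/-- A nontrivial idempotent is similar to a nonzero proper subidempotent of any nontrivial
idempotent. -/
theorem exists_similar_subidempotent (hpi : ∀ a : R, a ≠ 0 → ∃ x y : R, x * a * y = 1)
    {e g : R} (he : IsIdempotentElem e) (he0 : e ≠ 0) (he1 : e ≠ 1)
    (hg : IsIdempotentElem g) (hg0 : g ≠ 0) (hg1 : g ≠ 1) :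
    ∃ (g' : R) (u : Rˣ), IsIdempotentElem g' ∧ g' ≠ 0 ∧ g' ≠ 1 ∧
      g' = (u : R) * g * ((u⁻¹ : Rˣ) : R) ∧ g' * e = g' ∧ e * g' = g' ∧ g' ≠ e := by
  obtain ⟨s, t, hts, hes, hte, hst⟩ := exists_proper_embedding hpi he he0 he1 he he0
  have hg' := conj_embedding_idem hg hts
  have hr : s * g * t * e = s * g * t := by rw [mul_assoc, hte]
  have hl : e * (s * g * t) = s * g * t := by simp only [← mul_assoc, hes]
  have hg1' : s * g * t ≠ 1 := fun h => he1 <| by rwa [h, one_mul] at hr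
  have hgg : g * t * (s * g) = g := by
    calc g * t * (s * g) = g * (t * s) * g := by noncomm_ring
      _ = g := by rw [hts, mul_one, hg.eq]
  have hgg' : s * g * (g * t) = s * g * t := by
    rw [mul_assoc, ← mul_assoc g, hg.eq, mul_assoc]
  have φ : rightFixed g ≃ₗ[R] rightFixed (s * g * t) :=
    rightFixedEquiv (s := g * t) (t := s * g)
      (by rw [← hgg', ← mul_assoc, hgg, ← mul_assoc, hg.eq])
      (by rw [mul_assoc, hg.eq]) hgg hgg'
  obtain ⟨ψ⟩ := nonempty_rightFixed_compl_equiv hpi hg hg0 hg1 hg' hg1' φ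
  obtain ⟨u, hu⟩ := exists_unit_conj hg hg' φ ψ
  exact ⟨_, u, hg', conj_embedding_ne_zero hg0 hts, hg1', hu, hr, hl,
    conj_embedding_ne hts hes hst⟩

/-- A ring in which every nonzero element can be multiplied to `1` from both sides is oddly
decomposable. -/
theorem OddlyDecomposable.of_forall_exists_mul_mul_eq_one
    (hpi : ∀ a : R, a ≠ 0 → ∃ x y : R, x * a * y = 1) : OddlyDecomposable R := by
  intro e f he he0 he1 hf hf0 hf1
  obtain ⟨s, t, hts, hfs, htf, hst⟩ := exists_proper_embedding hpi he he0 he1 hf hf0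
  have hc := he.one_sub
  have hc0 : 1 - e ≠ 0 := sub_ne_zero.2 he1.symm
  have hne_one {g : R} (hg : f * g = g) : g ≠ 1 := fun h => hf1 <| by rwa [h, mul_one] at hg
  have hfb (b : R) : f * (s * b * t) = s * b * t := by simp only [← mul_assoc, hfs]
  have hbf (b : R) : s * b * t * f = s * b * t := by rw [mul_assoc, htf]
  have hmul (b c : R) : s * b * t * (s * c * t) = s * (b * c) * t := by
    calc s * b * t * (s * c * t) = s * b * (t * s) * c * t := by noncomm_ring
      _ = s * (b * c) * t := by rw [hts]; noncomm_ring
  have hr : f - s * 1 * t ≠ 0 := sub_ne_zero.2 (by rwa [mul_one, ne_comm])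
  have hri : IsIdempotentElem (f - s * 1 * t) :=
    sub_conj_embedding_idem hf .one hts hfs htf
  have hrf : f * (f - s * 1 * t) = f - s * 1 * t := by rw [mul_sub, hfb, hf.eq]
  have hrl (b : R) : s * b * t * (f - s * 1 * t) = 0 := by
    rw [mul_sub, hbf, hmul, mul_one, sub_self]
  have hrr (b : R) : (f - s * 1 * t) * (s * b * t) = 0 := by
    rw [sub_mul, hfb, hmul, one_mul, sub_self]
  have hec : s * e * t * (s * (1 - e) * t) = 0 := by
    rw [hmul, he.mul_one_sub_self, mul_zero, zero_mul]
  have hce : s * (1 - e) * t * (s * e * t) = 0 := by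
    rw [hmul, he.one_sub_mul_self, mul_zero, zero_mul]
  have hg : ∀ i, IsIdempotentElem (![s * e * t, s * (1 - e) * t, f - s * 1 * t] i) ∧
      ![s * e * t, s * (1 - e) * t, f - s * 1 * t] i ≠ 0 ∧
      ![s * e * t, s * (1 - e) * t, f - s * 1 * t] i ≠ 1 := by
    intro i
    fin_cases i
    · exact ⟨conj_embedding_idem he hts, conj_embedding_ne_zero he0 hts, hne_one (hfb _)⟩
    · exact ⟨conj_embedding_idem hc hts, conj_embedding_ne_zero hc0 hts, hne_one (hfb _)⟩
    · exact ⟨hri, hr, hne_one hrf⟩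
  refine ⟨3, by decide, le_rfl, _, hg, ?_, ?_, fun i =>
    exists_similar_subidempotent hpi he he0 he1 (hg i).1 (hg i).2.1 (hg i).2.2⟩
  · intro i j hij
    fin_cases i <;> fin_cases j <;>
      first | exact absurd rfl hij | exact hec | exact hce | exact hrl _ | exact hrr _
  · simp only [Fin.sum_univ_three, Matrix.cons_val]
    noncomm_ring

end PurelyInfinite

variable {A : Type*}
  [NormedRing A] [StarRing A] [CStarRing A] [CompleteSpace A]
  [NormedAlgebra ℂ A] [StarModule ℂ A]


theorem statement18 [IsSimpleRing A]
    (hpi : ∀ a : A, a ≠ 0 → ∃ x y : A, x * a * y = 1) :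
    OddlyDecomposable A :=
  .of_forall_exists_mul_mul_eq_one hpi

end
end
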